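/- arXiv:2603.05736 — 4 statements merged into one kernel-verified Lean document; each statement's English description precedes it below -/
import Mathlib

section
/- Let m ≥ 3 be an odd integer and k ≥ 0 an integer, let n = (2k + 1)(m + 2) and s = n − (m + 2). Then HOP(2^⟨s⟩, 4, 2m) has a solution, i.e., HOP(2^⟨s⟩, 2m_1, 2m_2) has a solution with (m_1, m_2) = (2, m) (tables of sizes 4 and 2m). (In the paper this is stated as: 4K_n^• admits an HOP (C_2, C_m)-decomposition, which by the paper's Theorem 3.2 is equivalent to the stated HOP solution.) -/
/-- The vertex set of the complete graph `K_{2n}`: the `n` couples are indexed by `Fin n`,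
and the two members of a couple by `Fin 2`. -/
abbrev HOPVertex (n : ℕ) : Type := Fin n × Fin 2

/-- The spouse of a participant: the other member of the same couple. -/
def HOPspouse {n : ℕ} (v : HOPVertex n) : HOPVertex n := (v.1, v.2 + 1)

/-- An edge of `K_{2n}` is an `I`-edge (an edge of the distinguished perfect matching `I`)
if it joins a participant to their spouse. -/
def IsIEdge {n : ℕ} (e : Sym2 (HOPVertex n)) : Prop :=
  ∃ v, e = s(v, HOPspouse v)

/-- An `I`-alternating `(K_2^⟨s⟩, C_{2m_1}, …, C_{2m_t})`-factor of `K_{2n}`: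
a spanning subgraph of `K_{2n}` which is a vertex-disjoint union of `s` edges of `I`
(one for each `a : Fin s`, namely the edge joining `pair a` to its spouse) together with
`t` cycles, the `i`-th of which has length `2 * m i` (given by the cyclic vertex sequence
`cyc i : ZMod (2 * m i) → HOPVertex n`), such that along each cycle the edges alternate
between `I`-edges (at even positions) and non-`I`-edges (at odd positions).
The field `spanning` says that the listed vertices are pairwise distinct and exhaust the
whole vertex set; in particular each `cyc i` is injective, so it really traces a cycle. -/
structure HOPFactor (n s t : ℕ) (m : Fin t → ℕ) : Type where
  pair : Fin s → HOPVertex n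
  cyc : (i : Fin t) → ZMod (2 * m i) → HOPVertex n
  alt_even : ∀ (i : Fin t) (j : ZMod (2 * m i)),
      j.val % 2 = 0 → cyc i (j + 1) = HOPspouse (cyc i j)
  alt_odd : ∀ (i : Fin t) (j : ZMod (2 * m i)),
      j.val % 2 = 1 → ¬ IsIEdge s(cyc i j, cyc i (j + 1))
  spanning : Function.Bijective
      (Sum.elim
        (fun a : Fin s × Fin 2 => if a.2 = 0 then pair a.1 else HOPspouse (pair a.1))
        (fun x : (i : Fin t) × ZMod (2 * m i) => cyc x.1 x.2))

/-- The edge set of an `I`-alternating `(K_2^⟨s⟩, C_{2m_1}, …, C_{2m_t})`-factor. -/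
def HOPFactor.edges {n s t : ℕ} {m : Fin t → ℕ} (F : HOPFactor n s t m) :
    Set (Sym2 (HOPVertex n)) :=
  {e | (∃ a : Fin s, e = s(F.pair a, HOPspouse (F.pair a))) ∨
    ∃ (i : Fin t) (j : ZMod (2 * m i)), e = s(F.cyc i j, F.cyc i (j + 1))}

/-- A solution to the generalized Honeymoon Oberwolfach Problem
`HOP(2^⟨s⟩, 2 m_1, …, 2 m_t)`: a family of `γ` `I`-alternating
`(K_2^⟨s⟩, C_{2m_1}, …, C_{2m_t})`-factors of `K_{2n}`, where `γ` is the natural number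
with `γ * (m_1 + ⋯ + m_t) = 2n(n-1)`, such that every edge of `K_{2n}` that is not an
`I`-edge lies in exactly one factor of the family. -/
def HOPSolution (n s t : ℕ) (m : Fin t → ℕ) : Prop :=
  ∃ γ : ℕ, γ * (∑ i, m i) = 2 * n * (n - 1) ∧
    ∃ F : Fin γ → HOPFactor n s t m,
      ∀ e : Sym2 (HOPVertex n), ¬ e.IsDiag → ¬ IsIEdge e →
        ∃! k : Fin γ, e ∈ (F k).edges

/-- The non-`I` edge number `j` of the alternating cycle with couples `c` and entry bits `b`. -/
def altEdge {V : Type*} (m : ℕ) (c : ℕ → V) (b : ℕ → Fin 2) (j : ℕ) : Sym2 (V × Fin 2) :=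
  s((c j, b j + 1), (c ((j + 1) % m), b ((j + 1) % m)))

theorem fin2_flip (x : Fin 2) : x + 1 + 1 = x := by revert x; decide

theorem HOPspouse_spouse {n : ℕ} (v : HOPVertex n) : HOPspouse (HOPspouse v) = v := by
  simp [HOPspouse, fin2_flip]

theorem not_isIEdge_of_ne {n : ℕ} {u v : HOPVertex n} (h : u.1 ≠ v.1) : ¬ IsIEdge s(u, v) := by
  rintro ⟨w, hw⟩
  rw [Sym2.eq_iff] at hw
  rcases hw with ⟨rfl, rfl⟩ | ⟨rfl, rfl⟩ <;> simp [HOPspouse] at h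

theorem zmod_val_add_one {N : ℕ} (hN : 2 ≤ N) (j : ZMod N) :
    (j + 1).val = (j.val + 1) % N := by
  have : Fact (1 < N) := ⟨hN⟩
  rw [ZMod.val_add, ZMod.val_one]

theorem mkFactor (n s t : ℕ) (m : Fin t → ℕ) (hm : ∀ i, 2 ≤ m i)
    (c : Fin t → ℕ → Fin n) (b : Fin t → ℕ → Fin 2)
    (hinj : ∀ i i' j j', j < m i → j' < m i' → c i j = c i' j' → i = i' ∧ j = j')
    (hs : s + ∑ i, m i = n) :
    ∃ F : HOPFactor n s t m,
      (∀ e ∈ F.edges, IsIEdge e ∨ ∃ i, ∃ j < m i, e = altEdge (m i) (c i) (b i) j) ∧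
      (∀ i, ∀ j < m i, altEdge (m i) (c i) (b i) j ∈ F.edges) := by
  classical
  have hne : ∀ i, NeZero (2 * m i) := fun i => ⟨by have := hm i; omega⟩
  let C : ((i : Fin t) × Fin (m i)) → Fin n := fun x => c x.1 x.2
  have hC : Function.Injective C := by
    rintro ⟨i, j, hj⟩ ⟨i', j', hj'⟩ h
    obtain ⟨rfl, h2⟩ := hinj i i' j j' hj hj' h
    subst h2; rfl
  let S : Finset (Fin n) := (Finset.univ.image C)ᶜ
  have hS : S.card = s := by
    rw [Finset.card_compl, Finset.card_image_of_injective _ hC]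
    simp
    omega
  let pe : Fin s ≃ S := (Fintype.equivFinOfCardEq (by simpa using hS)).symm
  let pr : Fin s → HOPVertex n := fun a => ((pe a : Fin n), 0)
  let cy : (i : Fin t) → ZMod (2 * m i) → HOPVertex n := fun i j =>
    (c i (j.val / 2), if j.val % 2 = 0 then b i (j.val / 2) else b i (j.val / 2) + 1)
  have hlt : ∀ i (j : ZMod (2 * m i)), j.val < 2 * m i := fun i j => ZMod.val_lt j
  have hsucc : ∀ i (j : ZMod (2 * m i)), (j + 1).val = (j.val + 1) % (2 * m i) := fun i j =>
    zmod_val_add_one (by have := hm i; omega) j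
  have heven : ∀ i (j : ZMod (2 * m i)), j.val % 2 = 0 → cy i (j + 1) = HOPspouse (cy i j) := by
    intro i j hj
    have h1 := hlt i j
    have h2 : (j + 1).val = j.val + 1 := by
      rw [hsucc, Nat.mod_eq_of_lt (by omega)]
    have h3 : (j.val + 1) / 2 = j.val / 2 := by omega
    have h4 : (j.val + 1) % 2 = 1 := by omega
    simp [cy, HOPspouse, h2, h3, h4, hj]
  have hodd : ∀ i (j : ZMod (2 * m i)), j.val % 2 = 1 →
      s(cy i j, cy i (j + 1)) = altEdge (m i) (c i) (b i) (j.val / 2) := by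
    intro i j hj
    have h1 := hlt i j
    have h3 : (j + 1).val / 2 = (j.val / 2 + 1) % m i ∧ (j + 1).val % 2 = 0 := by
      rw [hsucc]
      by_cases hh : j.val + 1 = 2 * m i
      · have : j.val / 2 + 1 = m i := by omega
        rw [hh, this]; simp
      · rw [Nat.mod_eq_of_lt (by omega), Nat.mod_eq_of_lt (by omega)]
        omega
    simp [cy, altEdge, h3.1, h3.2, hj]
  have hnotI : ∀ i, ∀ j < m i, ¬ IsIEdge (altEdge (m i) (c i) (b i) j) := by
    intro i j hj
    apply not_isIEdge_of_ne
    intro h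
    have h1 := hm i
    have h2 := (hinj i i j ((j + 1) % m i) hj (Nat.mod_lt _ (by omega)) h).2
    by_cases hh : j + 1 = m i
    · rw [hh, Nat.mod_self] at h2; omega
    · rw [Nat.mod_eq_of_lt (by omega)] at h2; omega
  let F : HOPFactor n s t m :=
    { pair := pr
      cyc := cy
      alt_even := heven
      alt_odd := by
        intro i j hj
        rw [hodd i j hj]
        exact hnotI i _ (by have := hlt i j; omega)
      spanning := by
        rw [Fintype.bijective_iff_surjective_and_card]
        constructor
        · rintro ⟨v, r⟩
          by_cases hv : v ∈ S
          · refine ⟨Sum.inl (pe.symm ⟨v, hv⟩, r), ?_⟩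
            fin_cases r <;> simp [pr, HOPspouse]
          · simp only [S, Finset.mem_compl, not_not, Finset.mem_image, Finset.mem_univ,
              true_and] at hv
            obtain ⟨⟨i, j, hj⟩, rfl⟩ := hv
            by_cases hr : r = b i j
            · refine ⟨Sum.inr ⟨i, ((2 * j : ℕ) : ZMod (2 * m i))⟩, ?_⟩
              have : ((2 * j : ℕ) : ZMod (2 * m i)).val = 2 * j :=
                ZMod.val_cast_of_lt (by omega)
              simp only [Sum.elim_inr, cy, this]
              simp [C, hr]
            · refine ⟨Sum.inr ⟨i, ((2 * j + 1 : ℕ) : ZMod (2 * m i))⟩, ?_⟩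
              have : ((2 * j + 1 : ℕ) : ZMod (2 * m i)).val = 2 * j + 1 :=
                ZMod.val_cast_of_lt (by omega)
              have h5 : (2 * j + 1) / 2 = j := by omega
              have h6 : (2 * j + 1) % 2 = 1 := by omega
              simp only [Sum.elim_inr, cy, this, h5, h6]
              have : ∀ x y : Fin 2, x ≠ y → y + 1 = x := by decide
              simp [C, this _ _ hr]
        · simp [ZMod.card, ← Finset.mul_sum]
          omega }
  refine ⟨F, ?_, ?_⟩
  · rintro e (⟨a, rfl⟩ | ⟨i, j, rfl⟩)
    · exact Or.inl ⟨_, rfl⟩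
    · rcases Nat.mod_two_eq_zero_or_one j.val with h | h
      · left
        exact ⟨F.cyc i j, by rw [← heven i j h]⟩
      · right
        exact ⟨i, j.val / 2, by have := hlt i j; omega, hodd i j h⟩
  · intro i j hj
    right
    have : ((2 * j + 1 : ℕ) : ZMod (2 * m i)).val = 2 * j + 1 :=
      ZMod.val_cast_of_lt (by omega)
    refine ⟨i, ((2 * j + 1 : ℕ) : ZMod (2 * m i)), ?_⟩
    have h := hodd i ((2 * j + 1 : ℕ) : ZMod (2 * m i)) (by rw [this]; omega)
    rw [this] at h
    have h5 : (2 * j + 1) / 2 = j := by omega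
    rw [h5] at h
    exact h.symm

theorem card_nonI (n : ℕ) :
    2 * n * (n - 1) ≤ Nat.card {e : Sym2 (HOPVertex n) // ¬ e.IsDiag ∧ ¬ IsIEdge e} := by
  classical
  rw [Nat.card_eq_fintype_card, Fintype.card_subtype]
  have h1 : (Finset.univ.filter fun e : Sym2 (HOPVertex n) => ¬ e.IsDiag).card
      = (2 * n).choose 2 := by
    rw [← Fintype.card_subtype, Sym2.card_subtype_not_diag]
    simp [mul_comm]
  let I : Finset (Sym2 (HOPVertex n)) :=
    Finset.univ.image fun v : Fin n => s((v, (0 : Fin 2)), (v, (1 : Fin 2)))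
  have h2 : I.card ≤ n := by
    refine Finset.card_image_le.trans ?_
    simp
  have h3 : (Finset.univ.filter fun e : Sym2 (HOPVertex n) => ¬ e.IsDiag) ⊆
      (Finset.univ.filter fun e : Sym2 (HOPVertex n) => ¬ e.IsDiag ∧ ¬ IsIEdge e) ∪ I := by
    intro e he
    simp only [Finset.mem_filter, Finset.mem_univ, true_and, Finset.mem_union] at he ⊢
    by_cases hI : IsIEdge e
    · right
      obtain ⟨⟨v, r⟩, rfl⟩ := hI
      simp only [I, Finset.mem_image, Finset.mem_univ, true_and]
      refine ⟨v, ?_⟩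
      fin_cases r
      · simp [HOPspouse]
      · simp [HOPspouse]
    · exact Or.inl ⟨he, hI⟩
  have h4 := (Finset.card_le_card h3).trans (Finset.card_union_le _ _)
  rw [h1] at h4
  have h5 : (2 * n).choose 2 = 2 * n * (n - 1) + n := by
    rw [Nat.choose_two_right]
    rcases n with _ | n
    · simp
    · apply Nat.div_eq_of_eq_mul_left (by norm_num)
      have : 2 * (n + 1) - 1 = 2 * n + 1 := by omega
      rw [this]; simp; ring
  omega

/-- If every non-`I` edge is covered, then by counting it is covered once. -/
theorem solution_of_cover (n s t : ℕ) (m : Fin t → ℕ) (hm : ∀ i, 2 ≤ m i)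
    {J : Type} [Fintype J]
    (c : J → Fin t → ℕ → Fin n) (b : J → Fin t → ℕ → Fin 2)
    (hinj : ∀ x i i' j j', j < m i → j' < m i' → c x i j = c x i' j' → i = i' ∧ j = j')
    (hs : s + ∑ i, m i = n) (hJ : Fintype.card J * ∑ i, m i = 2 * n * (n - 1))
    (hcov : ∀ (u v : Fin n) (r r' : Fin 2), u ≠ v →
      ∃ x i, ∃ j < m i, s((u, r), (v, r')) = altEdge (m i) (c x i) (b x i) j) :
    HOPSolution n s t m := by
  classical
  choose F hF1 hF2 using fun x : J => mkFactor n s t m hm (c x) (b x) (hinj x) hs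
  let e := Fintype.equivFin J
  refine ⟨Fintype.card J, hJ, fun k => F (e.symm k), ?_⟩
  let T := {e : Sym2 (HOPVertex n) // ¬ e.IsDiag ∧ ¬ IsIEdge e}
  have hne : ∀ x i j, j < m i → c x i j ≠ c x i ((j + 1) % m i) := by
    intro x i j hj h
    have h1 := hm i
    have h2 := (hinj x i i j ((j + 1) % m i) hj (Nat.mod_lt _ (by omega)) h).2
    by_cases hh : j + 1 = m i
    · rw [hh, Nat.mod_self] at h2; omega
    · rw [Nat.mod_eq_of_lt (by omega)] at h2; omega
  let Φ : J × ((i : Fin t) × Fin (m i)) → T := fun y =>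
    ⟨altEdge (m y.2.1) (c y.1 y.2.1) (b y.1 y.2.1) y.2.2, by
      constructor
      · intro h
        exact hne y.1 y.2.1 y.2.2 y.2.2.2 (congrArg Prod.fst (Sym2.mk_isDiag_iff.1 h))
      · exact not_isIEdge_of_ne (hne y.1 y.2.1 y.2.2 y.2.2.2)⟩
  have hcov' : ∀ e : Sym2 (HOPVertex n), ¬ e.IsDiag → ¬ IsIEdge e →
      ∃ x i, ∃ j < m i, e = altEdge (m i) (c x i) (b x i) j := by
    intro e
    induction e using Sym2.ind with
    | _ u v =>
      intro hd hI
      obtain ⟨u, r⟩ := u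
      obtain ⟨v, r'⟩ := v
      apply hcov
      rintro rfl
      rw [Sym2.mk_isDiag_iff] at hd
      apply hI
      refine ⟨(u, r), ?_⟩
      have : ∀ x y : Fin 2, x ≠ y → y = x + 1 := by decide
      have h := this r r' (fun h => hd (by rw [h]))
      simp [HOPspouse, h]
  have hsurj : Function.Surjective Φ := by
    rintro ⟨e, h1, h2⟩
    obtain ⟨x, i, j, hj, h⟩ := hcov' e h1 h2
    exact ⟨(x, ⟨i, j, hj⟩), Subtype.ext h.symm⟩
  have hcard : Fintype.card (J × ((i : Fin t) × Fin (m i))) = 2 * n * (n - 1) := by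
    simp [hJ]
  have hbij : Function.Bijective Φ := by
    rw [Fintype.bijective_iff_surjective_and_card]
    refine ⟨hsurj, le_antisymm ?_ (Fintype.card_le_of_surjective _ hsurj)⟩
    rw [hcard, ← Nat.card_eq_fintype_card]
    exact card_nonI n
  intro ed h1 h2
  obtain ⟨x, i, j, hj, h⟩ := hcov' ed h1 h2
  refine ⟨e x, ?_, ?_⟩
  · simp only [Equiv.symm_apply_apply]
    rw [h]
    exact hF2 x i j hj
  · intro k hk
    rcases hF1 _ _ hk with h3 | ⟨i', j', hj', h3⟩
    · exact absurd h3 h2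
    · have : Φ (x, ⟨i, j, hj⟩) = Φ (e.symm k, ⟨i', j', hj'⟩) :=
        Subtype.ext (h.symm.trans h3)
      have h4 := congrArg Prod.fst (hbij.1 this)
      simp only at h4
      rw [h4]; simp

/-- Specialisation to one `C_4` (with parity) and one `C_{2m}`, on any type of couples. -/
theorem solution_two (n s m : ℕ) (hm : 3 ≤ m) {V J : Type} [Fintype V] [Fintype J]
    (hV : Fintype.card V = n) (hs : s + (m + 2) = n)
    (hJ : Fintype.card J * (m + 2) = 2 * n * (n - 1))
    (p q : J → V) (π : J → Fin 2) (c : J → ℕ → V) (b : J → ℕ → Fin 2)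
    (hpq : ∀ x, p x ≠ q x)
    (hinj : ∀ x i j, i < m → j < m → c x i = c x j → i = j)
    (hp : ∀ x i, i < m → c x i ≠ p x) (hq : ∀ x i, i < m → c x i ≠ q x)
    (hcov : ∀ (u v : V) (r r' : Fin 2), u ≠ v →
      ∃ x, s((u, r), (v, r')) = s((p x, 0), (q x, π x)) ∨
        s((u, r), (v, r')) = s((p x, 1), (q x, π x + 1)) ∨
        ∃ j < m, s((u, r), (v, r')) = altEdge m (c x) (b x) j) :
    HOPSolution n s 2 ![2, m] := by
  classical
  let e : V ≃ Fin n := Fintype.equivFinOfCardEq hV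
  refine solution_of_cover n s 2 ![2, m] ?_ (J := J)
    (fun x => ![fun j => if j = 0 then e (p x) else e (q x), fun j => e (c x j)])
    (fun x => ![fun j => if j = 0 then 1 else π x, b x]) ?_ ?_ ?_ ?_
  · intro i; fin_cases i
    · simp
    · simp; omega
  · intro x i i' j j'
    fin_cases i <;> fin_cases i' <;> simp
    · intro h1 h2 h
      split_ifs at h
      · omega
      · exact absurd (e.injective h) (hpq x)
      · exact absurd (e.injective h).symm (hpq x)
      · omega
    · intro h1 h2 h
      split_ifs at h
      · exact hp x j' h2 (e.injective h).symm
      · exact hq x j' h2 (e.injective h).symm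
    · intro h1 h2 h
      split_ifs at h
      · exact hp x j h1 (e.injective h)
      · exact hq x j h1 (e.injective h)
    · intro h1 h2 h
      exact hinj x j j' h1 h2 h
  · simp; omega
  · simp; rw [← hJ]; ring
  · intro u v r r' huv
    obtain ⟨x, h⟩ := hcov (e.symm u) (e.symm v) r r' (by simpa using huv)
    have hmap : s((u, r), (v, r')) =
        Sym2.map (Prod.map e id) s((e.symm u, r), (e.symm v, r')) := by simp
    refine ⟨x, ?_⟩
    rcases h with h | h | ⟨j, hj, h⟩
    · refine ⟨0, 0, by simp, ?_⟩
      rw [hmap, h]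
      simp [altEdge]
    · refine ⟨0, 1, by simp, ?_⟩
      rw [hmap, h, Sym2.eq_swap]
      simp [altEdge]
    · refine ⟨1, j, by simpa using hj, ?_⟩
      rw [hmap, h]
      simp [altEdge]

/-- The non-`I` edges of a block. -/
def InBlk {V : Type*} (m : ℕ) (p q : V) (π : Fin 2) (c : ℕ → V) (b : ℕ → Fin 2)
    (e : Sym2 (V × Fin 2)) : Prop :=
  e = s((p, 0), (q, π)) ∨ e = s((p, 1), (q, π + 1)) ∨ ∃ j < m, e = altEdge m c b j

theorem InBlk_map {V W : Type*} (f : V → W) {m : ℕ} {p q : V} {π : Fin 2} {c : ℕ → V}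
    {b : ℕ → Fin 2} {u v : V} {r r' : Fin 2} (h : InBlk m p q π c b s((u, r), (v, r'))) :
    InBlk m (f p) (f q) π (fun i => f (c i)) b s((f u, r), (f v, r')) := by
  have hmap : s((f u, r), (f v, r')) = Sym2.map (Prod.map f id) s((u, r), (v, r')) := by simp
  rw [hmap]
  rcases h with h | h | ⟨j, hj, h⟩
  · left; rw [h]; simp
  · right; left; rw [h]; simp
  · right; right; refine ⟨j, hj, ?_⟩; rw [h]; simp [altEdge]

theorem InBlk_pq {V : Type*} {m : ℕ} {p q : V} {π : Fin 2} {c : ℕ → V} {b : ℕ → Fin 2}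
    {r r' : Fin 2} (h : π = r + r') : InBlk m p q π c b s((p, r), (q, r')) := by
  subst h
  revert r r'
  simp only [InBlk, Fin.forall_fin_two]
  simp

theorem InBlk_step {V : Type*} {m : ℕ} {p q : V} {π : Fin 2} {c : ℕ → V} {b : ℕ → Fin 2}
    {u v : V} {r r' : Fin 2} (j : ℕ) (hj : j + 1 < m) (hu : c j = u) (hv : c (j + 1) = v)
    (hr : b j + 1 = r) (hr' : b (j + 1) = r') : InBlk m p q π c b s((u, r), (v, r')) := by
  right; right
  refine ⟨j, by omega, ?_⟩
  simp [altEdge, Nat.mod_eq_of_lt hj, hu, hv, hr, hr']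

theorem InBlk_last {V : Type*} {m : ℕ} {p q : V} {π : Fin 2} {c : ℕ → V} {b : ℕ → Fin 2}
    {u v : V} {r r' : Fin 2} (j : ℕ) (hj : j + 1 = m) (hu : c j = u) (hv : c 0 = v)
    (hr : b j + 1 = r) (hr' : b 0 = r') : InBlk m p q π c b s((u, r), (v, r')) := by
  right; right
  refine ⟨j, by omega, ?_⟩
  simp [altEdge, hj, hu, hv, hr, hr']

theorem natCast_inj_of_lt {N a b : ℕ} (ha : a < N) (hb : b < N)
    (h : (a : ZMod N) = (b : ZMod N)) : a = b := by
  rw [ZMod.natCast_eq_natCast_iff'] at h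
  rwa [Nat.mod_eq_of_lt ha, Nat.mod_eq_of_lt hb] at h

/-! ### Blocks inside one group of `m + 2` couples -/

/-- The cycle missing the couple `x` and the star couple. -/
def c1 (m : ℕ) (x : Option (ZMod m)) (i : ℕ) : Option (Option (ZMod m)) :=
  match x with
  | none => some (some (i : ZMod m))
  | some x =>
    if i = 0 then some none
    else if i % 2 = 1 then some (some (x + ((i + 1) / 2 : ℕ)))
    else some (some (x - (i / 2 : ℕ)))

/-- Entry bits for `c1`. -/
def b1 {m : ℕ} (x : Option (ZMod m)) (β : Fin 2) (i : ℕ) : Fin 2 :=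
  match x with
  | none => β
  | some _ => if i = 0 then 0 else if (i / 2) % 2 = 0 then β else β + 1

theorem c1_inj (m : ℕ) (hm : 3 ≤ m) (hodd : m % 2 = 1) (x : Option (ZMod m)) (i j : ℕ)
    (hi : i < m) (hj : j < m) (h : c1 m x i = c1 m x j) : i = j := by
  have key : ∀ (x : ZMod m) (a b : ℕ), 0 < a → a + b < m → x + (a : ZMod m) ≠ x - (b : ZMod m) := by
    intro x a b ha hab h
    have h1 : ((a + b : ℕ) : ZMod m) = ((0 : ℕ) : ZMod m) := by
      push_cast; linear_combination h
    have := natCast_inj_of_lt hab (by omega) h1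
    omega
  cases x with
  | none =>
    simp only [c1, Option.some.injEq] at h
    exact natCast_inj_of_lt hi hj h
  | some x =>
    simp only [c1] at h
    split_ifs at h with h1 h2 h3 h4 h5 h6 h7 h8
    all_goals try simp only [Option.some.injEq, reduceCtorEq] at h
    all_goals try omega
    · have := natCast_inj_of_lt (by omega) (by omega) (add_left_cancel h); omega
    · exact absurd h (key _ _ _ (by omega) (by omega))
    · exact absurd h.symm (key _ _ _ (by omega) (by omega))
    · have := natCast_inj_of_lt (by omega) (by omega) (sub_right_injective h); omega

theorem c1_ne_none (m : ℕ) (x : Option (ZMod m)) (i : ℕ) : c1 m x i ≠ none := by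
  cases x with
  | none => simp [c1]
  | some x => simp only [c1]; split_ifs <;> simp

theorem c1_ne_some (m : ℕ) (hm : 3 ≤ m) (x : Option (ZMod m)) (i : ℕ) (hi : i < m) :
    c1 m x i ≠ some x := by
  cases x with
  | none => simp [c1]
  | some x =>
    simp only [c1]
    split_ifs with h1 h2
    · simp
    · intro h
      simp only [Option.some.injEq, add_eq_left] at h
      have := natCast_inj_of_lt (N := m) (a := (i + 1) / 2) (b := 0) (by omega) (by omega) (by simpa using h)
      omega
    · intro h
      simp only [Option.some.injEq, sub_eq_self] at h
      have := natCast_inj_of_lt (N := m) (a := i / 2) (b := 0) (by omega) (by omega) (by simpa using h)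
      omega

/-- Membership in block `(x, β)`. -/
def In1 (m : ℕ) (x : Option (ZMod m)) (β : Fin 2)
    (e : Sym2 (Option (Option (ZMod m)) × Fin 2)) : Prop :=
  InBlk m none (some x) β (c1 m x) (b1 x β) e

theorem cov1_star (m : ℕ) (x : Option (ZMod m)) (r r' : Fin 2) :
    ∃ y β, In1 m y β s((none, r), (some x, r')) :=
  ⟨x, r + r', InBlk_pq rfl⟩

theorem cov1_inf (m : ℕ) (hm : 3 ≤ m) (hodd : m % 2 = 1) (y : ZMod m) (r r' : Fin 2) :
    ∃ x β, In1 m x β s((some none, r), (some (some y), r')) := by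
  fin_cases r
  · rw [Sym2.eq_swap]
    by_cases hh : ((m - 1) / 2) % 2 = 0
    · refine ⟨some (y + ((m - 1) / 2 : ℕ)), r' + 1, ?_⟩
      refine InBlk_last (m - 1) (by omega) ?_ ?_ ?_ ?_
      · have h1 : m - 1 ≠ 0 := by omega
        have h2 : (m - 1) % 2 ≠ 1 := by omega
        simp [c1, h1, h2]
      · simp [c1]
      · have h1 : m - 1 ≠ 0 := by omega
        simp [b1, h1, hh, fin2_flip]
      · simp [b1]
    · refine ⟨some (y + ((m - 1) / 2 : ℕ)), r', ?_⟩
      refine InBlk_last (m - 1) (by omega) ?_ ?_ ?_ ?_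
      · have h1 : m - 1 ≠ 0 := by omega
        have h2 : (m - 1) % 2 ≠ 1 := by omega
        simp [c1, h1, h2]
      · simp [c1]
      · have h1 : m - 1 ≠ 0 := by omega
        have hh' : ((m - 1) / 2) % 2 = 1 := by omega
        simp [b1, h1, hh', fin2_flip]
      · simp [b1]
  · refine ⟨some (y - 1), r', ?_⟩
    refine InBlk_step 0 (by omega) ?_ ?_ ?_ ?_
    · simp [c1]
    · simp [c1]
    · simp [b1]
    · simp [b1]

theorem cov1_even (m : ℕ) (hm : 3 ≤ m) (hodd : m % 2 = 1) (y : ZMod m) (t : ℕ) (ht : t % 2 = 0)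
    (ht0 : 2 ≤ t) (htm : t < m) (r r' : Fin 2) :
    ∃ x β, In1 m x β s((some (some y), r), (some (some (y - (t : ZMod m))), r')) := by
  obtain ⟨w, rfl⟩ : ∃ w, t = 2 * w := ⟨t / 2, by omega⟩
  have hcases : ∀ a b : Fin 2, b = a ∨ a = b + 1 := by decide
  rcases hcases r r' with h | h
  · subst h
    -- the step number `2 w - 1`, from `x + w` to `x - w`
    obtain ⟨β, hβ⟩ : ∃ β : Fin 2, (if (2 * w / 2) % 2 = 0 then β else β + 1) = r' := by
      split_ifs
      · exact ⟨r', rfl⟩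
      · exact ⟨r' + 1, fin2_flip _⟩
    refine ⟨some (y - (w : ZMod m)), β, ?_⟩
    have e1 : 2 * w - 1 + 1 = 2 * w := by omega
    have e2 : 2 * w / 2 = w := by omega
    have e3 : (2 * w - 1) / 2 = w - 1 := by omega
    refine InBlk_step (2 * w - 1) (by omega) ?_ ?_ ?_ ?_
    · have h1 : 2 * w - 1 ≠ 0 := by omega
      have h2 : (2 * w - 1) % 2 = 1 := by omega
      simp only [c1, h1, h2, e1, e2, if_true, if_false]
      simp
    · have h1 : 2 * w ≠ 0 := by omega
      have h2 : (2 * w) % 2 ≠ 1 := by omega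
      simp only [c1, e1, h1, h2, e2, if_false]
      congr 2
      push_cast; ring
    · have h1 : 2 * w - 1 ≠ 0 := by omega
      simp only [b1, h1, e3, if_false]
      rw [e2] at hβ
      split_ifs at hβ ⊢
      · omega
      · exact hβ
      · rw [← hβ, fin2_flip]
      · omega
    · have h1 : 2 * w ≠ 0 := by omega
      simp only [b1, e1, h1, if_false]
      exact hβ
  · subst h
    by_cases hl : 2 * w + 1 = m
    · refine ⟨none, r', ?_⟩
      have hw : y - ((2 * w : ℕ) : ZMod m) = y + 1 := by
        have : ((2 * w + 1 : ℕ) : ZMod m) = 0 := by rw [hl]; simp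
        push_cast at this ⊢
        linear_combination -this
      rw [hw]
      have : NeZero m := ⟨by omega⟩
      have hy : ((y.val : ℕ) : ZMod m) = y := ZMod.natCast_zmod_val y
      by_cases hlast : y.val + 1 = m
      · refine InBlk_last y.val hlast ?_ ?_ ?_ ?_
        · simp only [c1, hy]
        · simp only [c1]
          congr 2
          have : ((y.val + 1 : ℕ) : ZMod m) = 0 := by rw [hlast]; simp
          rw [← hy]; push_cast at this ⊢; rw [this]
        · simp [b1]
        · simp [b1]
      · have := ZMod.val_lt y
        refine InBlk_step y.val (by omega) ?_ ?_ ?_ ?_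
        · simp only [c1, hy]
        · simp only [c1]; push_cast; rw [hy]
        · simp [b1]
        · simp [b1]
    · -- the step number `i = m - t - 1`, from `x - i / 2` to `x + i / 2 + 1`
      obtain ⟨a, ha⟩ : ∃ a, m = 2 * w + 2 * a + 1 := ⟨(m - 2 * w - 1) / 2, by omega⟩
      obtain ⟨β, hβ⟩ : ∃ β : Fin 2, (if a % 2 = 0 then β else β + 1) = r' := by
        split_ifs
        · exact ⟨r', rfl⟩
        · exact ⟨r' + 1, fin2_flip _⟩
      have h0 : (2 * (w : ZMod m) + 2 * (a : ZMod m) + 1) = 0 := by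
        have : ((2 * w + 2 * a + 1 : ℕ) : ZMod m) = 0 := by rw [← ha]; simp
        push_cast at this; exact this
      refine ⟨some (y + (a : ZMod m)), β, ?_⟩
      have e2 : 2 * a / 2 = a := by omega
      have e3 : (2 * a + 1) / 2 = a := by omega
      have e4 : (2 * a + 1 + 1) / 2 = a + 1 := by omega
      have h1 : 2 * a ≠ 0 := by omega
      have h2 : (2 * a) % 2 ≠ 1 := by omega
      have h3 : 2 * a + 1 ≠ 0 := by omega
      have h4 : (2 * a + 1) % 2 = 1 := by omega
      refine InBlk_step (2 * a) (by omega) ?_ ?_ ?_ ?_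
      · simp only [c1, h1, h2, e2, if_false]
        simp
      · simp only [c1, h3, h4, e4, if_true, if_false]
        congr 2
        push_cast
        linear_combination h0
      · simp only [b1, h1, e2, if_false]
        rw [hβ]
      · simp only [b1, h3, e3, if_false]
        exact hβ

theorem cov1 (m : ℕ) (hm : 3 ≤ m) (hodd : m % 2 = 1) (u v : Option (Option (ZMod m)))
    (r r' : Fin 2) (huv : u ≠ v) : ∃ x β, In1 m x β s((u, r), (v, r')) := by
  match u, v with
  | none, none => exact absurd rfl huv
  | none, some x => exact cov1_star m x r r'
  | some x, none => rw [Sym2.eq_swap]; exact cov1_star m x r' r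
  | some none, some none => exact absurd rfl huv
  | some none, some (some y) => exact cov1_inf m hm hodd y r r'
  | some (some y), some none => rw [Sym2.eq_swap]; exact cov1_inf m hm hodd y r' r
  | some (some y), some (some z) =>
    have : NeZero m := ⟨by omega⟩
    have hyz : y - z ≠ 0 := by
      intro h; apply huv; rw [sub_eq_zero.1 h]
    have h1 : (y - z).val ≠ 0 := by rwa [Ne, ZMod.val_eq_zero]
    have h2 := ZMod.val_lt (y - z)
    have h3 : (((y - z).val : ℕ) : ZMod m) = y - z := ZMod.natCast_zmod_val _
    rcases Nat.mod_two_eq_zero_or_one (y - z).val with h | h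
    · have := cov1_even m hm hodd y (y - z).val h (by omega) h2 r r'
      rw [h3, sub_sub_cancel] at this
      exact this
    · have := cov1_even m hm hodd z (m - (y - z).val) (by omega) (by omega) (by omega) r' r
      rw [Nat.cast_sub h2.le, h3] at this
      rw [Sym2.eq_swap]
      have e : z - (((m : ℕ) : ZMod m) - (y - z)) = y := by simp
      rw [e] at this
      exact this

/-! ### Blocks between different groups -/

/-- The second coordinate of the zigzag path. -/
def yv (m i : ℕ) : ℕ :=
  if i % 2 = 0 then i / 2 + (if m % 4 = 1 ∧ 2 ≤ i then 1 else 0)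
  else m + 1 - i / 2 - (if (m + 1) / 2 ≤ i then 1 else 0)

/-- The first leftover difference. -/
def du (m : ℕ) : ℕ := if m = 3 then 3 else 1

/-- The second leftover difference. -/
def dv (m : ℕ) : ℕ := if m % 4 = 1 then m else 2

theorem yv_zero (m : ℕ) : yv m 0 = 0 := by simp [yv]

theorem yv_odd_lt (m i : ℕ) (hi : i % 2 = 1) (h : i < (m + 1) / 2) :
    yv m i = m + 1 - i / 2 := by
  rw [yv, if_neg (by omega), if_neg (by omega)]; rfl

theorem yv_odd_ge (m i : ℕ) (hi : i % 2 = 1) (h : (m + 1) / 2 ≤ i) :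
    yv m i = m + 1 - i / 2 - 1 := by
  rw [yv, if_neg (by omega), if_pos (by omega)]

theorem yv_even_one (m i : ℕ) (hm : m % 4 = 1) (hi : i % 2 = 0) (h : 2 ≤ i) :
    yv m i = i / 2 + 1 := by
  rw [yv, if_pos hi, if_pos ⟨hm, h⟩]

theorem yv_even_three (m i : ℕ) (hm : ¬ m % 4 = 1) (hi : i % 2 = 0) :
    yv m i = i / 2 := by
  rw [yv, if_pos hi, if_neg (fun h => hm h.1)]; rfl

theorem yv_arith (m A : ℕ) (hm : 3 ≤ m) (hodd : m % 2 = 1) (hA : 1 ≤ A) (hA' : A ≤ m + 1)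
    (h1 : A ≠ du m) (h2 : A ≠ dv m) (h3 : yv m (m - 2) + A ≠ m + 2) :
    ∃ j, j + 2 < m ∧ ((j % 2 = 0 ∧ yv m (j + 1) = yv m j + A) ∨
      (j % 2 = 1 ∧ yv m j = yv m (j + 1) + A)) := by
  by_cases hm3 : m = 3
  · subst hm3
    have e1 : yv 3 1 = 4 := by decide
    have e2 : du 3 = 3 := by decide
    have e3 : dv 3 = 2 := by decide
    have hA4 : A = 4 := by
      simp only [show 3 - 2 = 1 from rfl, e1] at h3
      omega
    subst hA4
    exact ⟨0, by omega, Or.inl ⟨rfl, by decide⟩⟩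
  rw [du, if_neg hm3] at h1
  rw [yv, if_neg (by omega), if_pos (by omega)] at h3
  unfold dv at h2
  by_cases hε : m % 4 = 1
  · rw [if_pos hε] at h2
    obtain ⟨q, rfl⟩ : ∃ q, m = 4 * q + 1 := ⟨m / 4, by omega⟩
    rcases eq_or_ne A (4 * q + 1 + 1) with h | h
    · refine ⟨0, by omega, Or.inl ⟨rfl, ?_⟩⟩
      rw [yv_odd_lt _ _ rfl (by omega), yv_zero]
      omega
    rcases le_or_gt A (2 * q) with h' | h'
    · obtain ⟨j, hj⟩ : ∃ j, j + A = 4 * q := ⟨4 * q - A, by omega⟩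
      refine ⟨j, by omega, ?_⟩
      rcases Nat.mod_two_eq_zero_or_one j with hp | hp
      · rw [yv_odd_ge _ (j + 1) (by omega) (by omega), yv_even_one _ j hε hp (by omega)]
        omega
      · rw [yv_odd_ge _ j (by omega) (by omega), yv_even_one _ (j + 1) hε (by omega) (by omega)]
        omega
    · obtain ⟨j, hj⟩ : ∃ j, j + A = 4 * q + 1 := ⟨4 * q + 1 - A, by omega⟩
      refine ⟨j, by omega, ?_⟩
      rcases Nat.mod_two_eq_zero_or_one j with hp | hp
      · rw [yv_odd_lt _ (j + 1) (by omega) (by omega), yv_even_one _ j hε hp (by omega)]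
        omega
      · rw [yv_odd_lt _ j (by omega) (by omega), yv_even_one _ (j + 1) hε (by omega) (by omega)]
        omega
  · rw [if_neg hε] at h2
    obtain ⟨q, rfl⟩ : ∃ q, m = 4 * q + 3 := ⟨m / 4, by omega⟩
    rcases le_or_gt A (2 * q + 1) with h' | h'
    · obtain ⟨j, hj⟩ : ∃ j, j + A = 4 * q + 3 := ⟨4 * q + 3 - A, by omega⟩
      refine ⟨j, by omega, ?_⟩
      rcases Nat.mod_two_eq_zero_or_one j with hp | hp
      · rw [yv_odd_ge _ (j + 1) (by omega) (by omega), yv_even_three _ j hε hp]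
        omega
      · rw [yv_odd_ge _ j (by omega) (by omega), yv_even_three _ (j + 1) hε (by omega)]
        omega
    · obtain ⟨j, hj⟩ : ∃ j, j + A = 4 * q + 4 := ⟨4 * q + 4 - A, by omega⟩
      refine ⟨j, by omega, ?_⟩
      rcases Nat.mod_two_eq_zero_or_one j with hp | hp
      · rw [yv_odd_lt _ (j + 1) (by omega) (by omega), yv_even_three _ j hε hp]
        omega
      · rw [yv_odd_lt _ j (by omega) (by omega), yv_even_three _ (j + 1) hε (by omega)]
        omega

theorem yv_lt (m i : ℕ) (hm : 3 ≤ m) (hi : i + 1 < m) : yv m i < m + 2 := by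
  unfold yv
  split_ifs <;> omega

theorem yv_inj (m i j : ℕ) (hi : i + 1 < m) (hj : j + 1 < m) (hij : i % 2 = j % 2)
    (h : yv m i = yv m j) : i = j := by
  unfold yv at h
  split_ifs at h <;> omega

theorem yv_pos (m i : ℕ) (hi : i + 1 < m) (hodd : i % 2 = 1) : yv m i ≠ 0 := by
  unfold yv
  split_ifs <;> omega

/-- The cycle of a block between groups. -/
def c2 {R : Type*} [CommRing R] (m : ℕ) (D : R) (g : R × ZMod (m + 2)) (i : ℕ) :
    R × ZMod (m + 2) :=
  if i + 1 = m then (g.1 + 2 * D, g.2)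
  else if i % 2 = 0 then (g.1, g.2 + (yv m i : ZMod (m + 2)))
  else (g.1 + D, g.2 + (yv m i : ZMod (m + 2)))

/-- Entry bits for `c2`. -/
def b2 (m : ℕ) (x y : Fin 2) (i : ℕ) : Fin 2 :=
  if i + 1 = m then x + y else if i % 2 = 0 then x else y

/-- The first couple of the `C_4`. -/
def p2 {R : Type*} [CommRing R] (m : ℕ) (D : R) (g : R × ZMod (m + 2)) : R × ZMod (m + 2) :=
  (g.1 + D, g.2)

/-- The second couple of the `C_4`. -/
def q2 {R : Type*} [CommRing R] (m : ℕ) (D : R) (g : R × ZMod (m + 2)) (x : Fin 2) :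
    R × ZMod (m + 2) :=
  (g.1 + 2 * D, g.2 + ((if x = 0 then du m else dv m : ℕ) : ZMod (m + 2)))

theorem p2_ne_q2 {R : Type*} [CommRing R] (m : ℕ) (D : R) (hD : D ≠ 0) (g : R × ZMod (m + 2))
    (x : Fin 2) : p2 m D g ≠ q2 m D g x := by
  intro h
  have := congrArg Prod.fst h
  simp only [p2, q2] at this
  apply hD
  linear_combination -this

theorem c2_inj {R : Type*} [CommRing R] (m : ℕ) (hm : 3 ≤ m) (D : R) (hD : D ≠ 0)
    (hD2 : 2 * D ≠ 0) (g : R × ZMod (m + 2)) (i j : ℕ) (hi : i < m) (hj : j < m)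
    (h : c2 m D g i = c2 m D g j) : i = j := by
  have f1 : g.1 + 2 * D ≠ g.1 + D := fun h => hD (by linear_combination h)
  have f2 : g.1 + 2 * D ≠ g.1 := fun h => hD2 (by linear_combination h)
  have f3 : g.1 + D ≠ g.1 := fun h => hD (by linear_combination h)
  unfold c2 at h
  split_ifs at h with h1 h2 h3 h4 h5 h6 h7 h8
  all_goals rw [Prod.mk.injEq] at h
  all_goals first
    | omega
    | exact absurd h.1 f1
    | exact absurd h.1 f2
    | exact absurd h.1 f3
    | exact absurd h.1.symm f1
    | exact absurd h.1.symm f2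
    | exact absurd h.1.symm f3
    | exact yv_inj m i j (by omega) (by omega) (by omega) (natCast_inj_of_lt
        (yv_lt m i hm (by omega)) (yv_lt m j hm (by omega)) (add_left_cancel h.2))

theorem c2_ne_p2 {R : Type*} [CommRing R] (m : ℕ) (hm : 3 ≤ m) (D : R) (hD : D ≠ 0)
    (g : R × ZMod (m + 2)) (i : ℕ) (hi : i < m) : c2 m D g i ≠ p2 m D g := by
  have f1 : g.1 + 2 * D ≠ g.1 + D := fun h => hD (by linear_combination h)
  have f3 : g.1 ≠ g.1 + D := fun h => hD (by linear_combination -h)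
  unfold c2 p2
  intro h
  split_ifs at h with h1 h2
  all_goals rw [Prod.mk.injEq] at h
  · exact f1 h.1
  · exact f3 h.1
  · refine yv_pos m i (by omega) (by omega) (natCast_inj_of_lt (N := m + 2)
      (yv_lt m i hm (by omega)) (by omega) ?_)
    simpa using h.2

theorem c2_ne_q2 {R : Type*} [CommRing R] (m : ℕ) (hm : 3 ≤ m) (D : R) (hD : D ≠ 0)
    (hD2 : 2 * D ≠ 0) (g : R × ZMod (m + 2)) (x : Fin 2) (i : ℕ) :
    c2 m D g i ≠ q2 m D g x := by
  have f1 : g.1 + D ≠ g.1 + 2 * D := fun h => hD (by linear_combination -h)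
  have f2 : g.1 ≠ g.1 + 2 * D := fun h => hD2 (by linear_combination -h)
  unfold c2 q2
  intro h
  split_ifs at h with h1 hx h2 h3 h4
  all_goals rw [Prod.mk.injEq] at h
  all_goals first
    | exact f1 h.1
    | exact f2 h.1
    | skip
  · have h5 : ((du m : ℕ) : ZMod (m + 2)) = ((0 : ℕ) : ZMod (m + 2)) := by simpa using h.2
    have h6 : du m < m + 2 ∧ du m ≠ 0 := by unfold du; split_ifs <;> omega
    exact h6.2 (natCast_inj_of_lt h6.1 (by omega) h5)
  · have h5 : ((dv m : ℕ) : ZMod (m + 2)) = ((0 : ℕ) : ZMod (m + 2)) := by simpa using h.2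
    have h6 : dv m < m + 2 ∧ dv m ≠ 0 := by unfold dv; split_ifs <;> omega
    exact h6.2 (natCast_inj_of_lt h6.1 (by omega) h5)

/-- Membership in a block between groups. -/
def In2 {R : Type*} [CommRing R] (m : ℕ) (D : R) (g : R × ZMod (m + 2)) (x y : Fin 2)
    (e : Sym2 ((R × ZMod (m + 2)) × Fin 2)) : Prop :=
  InBlk m (p2 m D g) (q2 m D g x) y (c2 m D g) (b2 m x y) e

theorem cov2_zero {R : Type*} [CommRing R] (m : ℕ) (hm : 3 ≤ m) (D : R)
    (u : R × ZMod (m + 2)) (r r' : Fin 2) :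
    ∃ g x y, In2 m D g x y s((u, r), ((u.1 + 2 * D, u.2), r')) := by
  refine ⟨u, r, r' + r + 1, ?_⟩
  rw [Sym2.eq_swap]
  have h1 : ¬ (0 + 1 = m) := by omega
  have h2 : m - 1 + 1 = m := by omega
  refine InBlk_last (m - 1) h2 ?_ ?_ ?_ ?_
  · simp only [c2, h2, if_true]
  · simp only [c2, h1, if_false]
    simp [yv_zero]
  · simp only [b2, h2, if_true]
    revert r r'; decide
  · simp only [b2, h1, if_false]
    simp

theorem cov2_ne {R : Type*} [CommRing R] (m : ℕ) (hm : 3 ≤ m) (hodd : m % 2 = 1) (D : R)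
    (u : R × ZMod (m + 2)) (a : ZMod (m + 2)) (ha : a ≠ 0) (r r' : Fin 2) :
    ∃ g x y, In2 m D g x y s((u, r), ((u.1 + D, u.2 + a), r')) := by
  obtain ⟨A, hA0, hA1, rfl⟩ : ∃ A : ℕ, 1 ≤ A ∧ A ≤ m + 1 ∧ a = (A : ZMod (m + 2)) := by
    refine ⟨a.val, ?_, ?_, (ZMod.natCast_zmod_val a).symm⟩
    · have : a.val ≠ 0 := by rwa [Ne, ZMod.val_eq_zero]
      omega
    · have := ZMod.val_lt a; omega
  have key : ∀ x : Fin 2, A = (if x = 0 then du m else dv m) →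
      ∃ g x y, In2 m D g x y s((u, r), ((u.1 + D, u.2 + (A : ZMod (m + 2))), r')) := by
    intro x hx
    refine ⟨(u.1 - D, u.2), x, r + r', ?_⟩
    have e1 : u = p2 m D (u.1 - D, u.2) := by simp [p2]
    have e2 : (u.1 + D, u.2 + (A : ZMod (m + 2))) = q2 m D (u.1 - D, u.2) x := by
      simp only [q2, ← hx]
      congr 1
      ring
    rw [e2]
    nth_rewrite 3 [e1]
    exact InBlk_pq rfl
  by_cases h1 : A = du m
  · exact key 0 (by simpa using h1)
  by_cases h2 : A = dv m
  · exact key 1 (by simpa using h2)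
  clear key
  by_cases h3 : yv m (m - 2) + A = m + 2
  · have h0 : (yv m (m - 2) : ZMod (m + 2)) + (A : ZMod (m + 2)) = 0 := by
      have : ((yv m (m - 2) + A : ℕ) : ZMod (m + 2)) = ((m + 2 : ℕ) : ZMod (m + 2)) := by rw [h3]
      rw [ZMod.natCast_self] at this
      push_cast at this
      exact this
    refine ⟨(u.1 - D, u.2 + (A : ZMod (m + 2))), r' + r + 1, r + 1, ?_⟩
    have e1 : m - 2 + 1 + 1 = m := by omega
    have e2 : ¬ (m - 2 + 1 = m) := by omega
    have e3 : ¬ ((m - 2) % 2 = 0) := by omega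
    refine InBlk_step (m - 2) (by omega) ?_ ?_ ?_ ?_
    · simp only [c2, e2, e3, if_false]
      ext
      · simp
      · simp only; linear_combination h0
    · simp only [c2, e1, if_true]
      ext
      · simp only; ring
      · simp
    · simp only [b2, e2, e3, if_false]
      revert r; decide
    · simp only [b2, e1, if_true]
      revert r r'; decide
  obtain ⟨j, hj, h | h⟩ := yv_arith m A hm hodd hA0 hA1 h1 h2 h3
  · obtain ⟨hj2, hy⟩ := h
    refine ⟨(u.1, u.2 - (yv m j : ZMod (m + 2))), r + 1, r', ?_⟩
    have e1 : ¬ (j + 1 = m) := by omega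
    have e2 : ¬ (j + 1 + 1 = m) := by omega
    have e3 : ¬ ((j + 1) % 2 = 0) := by omega
    refine InBlk_step j (by omega) ?_ ?_ ?_ ?_
    · simp [c2, e1, hj2]
    · simp only [c2, e2, e3, if_false]
      rw [hy]
      push_cast
      ext
      · simp
      · simp only; ring
    · simp only [b2, e1, hj2, if_false, if_true]
      revert r; decide
    · simp only [b2, e2, e3, if_false]
  · obtain ⟨hj2, hy⟩ := h
    refine ⟨(u.1, u.2 - (yv m (j + 1) : ZMod (m + 2))), r, r' + 1, ?_⟩
    rw [Sym2.eq_swap]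
    have e1 : ¬ (j + 1 = m) := by omega
    have e2 : ¬ (j + 1 + 1 = m) := by omega
    have e3 : (j + 1) % 2 = 0 := by omega
    have e4 : ¬ (j % 2 = 0) := by omega
    refine InBlk_step j (by omega) ?_ ?_ ?_ ?_
    · simp only [c2, e1, e4, if_false]
      rw [hy]
      push_cast
      ext
      · simp
      · simp only; ring
    · simp [c2, e2, e3]
    · simp only [b2, e1, e4, if_false]
      revert r'; decide
    · simp only [b2, e2, e3, if_false, if_true]

theorem half_set (k : ℕ) (δ : ZMod (2 * k + 1)) (hδ : δ ≠ 0) :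
    ∃ d : Fin k, δ = ((d + 1 : ℕ) : ZMod (2 * k + 1)) ∨
      δ = -((d + 1 : ℕ) : ZMod (2 * k + 1)) := by
  have h1 : δ.val ≠ 0 := by rwa [Ne, ZMod.val_eq_zero]
  have h2 := ZMod.val_lt δ
  have h3 : ((δ.val : ℕ) : ZMod (2 * k + 1)) = δ := ZMod.natCast_zmod_val _
  by_cases h : δ.val ≤ k
  · refine ⟨⟨δ.val - 1, by omega⟩, Or.inl ?_⟩
    have : δ.val - 1 + 1 = δ.val := by omega
    simp only [this, h3]
  · refine ⟨⟨2 * k - δ.val, by omega⟩, Or.inr ?_⟩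
    have : 2 * k - δ.val + 1 = (2 * k + 1) - δ.val := by omega
    simp only [this]
    rw [Nat.cast_sub h2.le, h3, ZMod.natCast_self]
    ring

theorem half_ne (k : ℕ) (d : Fin k) : ((d + 1 : ℕ) : ZMod (2 * k + 1)) ≠ 0 ∧
    2 * ((d + 1 : ℕ) : ZMod (2 * k + 1)) ≠ 0 := by
  have := d.2
  constructor
  · intro h
    have := natCast_inj_of_lt (N := 2 * k + 1) (a := d + 1) (b := 0) (by omega) (by omega)
      (by rw [h]; simp)
    omega
  · intro h
    have := natCast_inj_of_lt (N := 2 * k + 1) (a := 2 * (d + 1)) (b := 0) (by omega) (by omega)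
      (by rw [Nat.cast_mul, Nat.cast_ofNat, h]; simp)
    omega

theorem cov2 (m k : ℕ) (hm : 3 ≤ m) (hodd : m % 2 = 1)
    (u v : ZMod (2 * k + 1) × ZMod (m + 2)) (r r' : Fin 2) (huv : u.1 ≠ v.1) :
    ∃ (d : Fin k) (g : ZMod (2 * k + 1) × ZMod (m + 2)) (x y : Fin 2),
      In2 m ((d + 1 : ℕ) : ZMod (2 * k + 1)) g x y s((u, r), (v, r')) := by
  have hδ : v.1 - u.1 ≠ 0 := fun h => huv (sub_eq_zero.1 h).symm
  by_cases ha : v.2 - u.2 = 0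
  · have ha' : v.2 = u.2 := sub_eq_zero.1 ha
    have h2 : (2 : ZMod (2 * k + 1)) * ((k : ZMod (2 * k + 1)) + 1) = 1 := by
      have : ((2 * k + 1 : ℕ) : ZMod (2 * k + 1)) = 0 := ZMod.natCast_self _
      push_cast at this
      linear_combination this
    have h3 : 2 * (((k : ZMod (2 * k + 1)) + 1) * (v.1 - u.1)) = v.1 - u.1 := by
      rw [← mul_assoc, h2, one_mul]
    obtain ⟨d, h | h⟩ := half_set k (((k : ZMod (2 * k + 1)) + 1) * (v.1 - u.1))
      (fun h => hδ (by rw [← h3, h, mul_zero]))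
    · refine ⟨d, ?_⟩
      have := cov2_zero m hm ((d + 1 : ℕ) : ZMod (2 * k + 1)) u r r'
      rw [← h, h3] at this
      have e : (u.1 + (v.1 - u.1), u.2) = v := by ext <;> simp [ha']
      rw [e, h] at this
      exact this
    · refine ⟨d, ?_⟩
      have := cov2_zero m hm ((d + 1 : ℕ) : ZMod (2 * k + 1)) v r' r
      have e : (v.1 + 2 * ((d + 1 : ℕ) : ZMod (2 * k + 1)), v.2) = u := by
        ext
        · simp only
          linear_combination 2 * h - h3
        · exact ha'
      rw [e, Sym2.eq_swap] at this
      exact this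
  · obtain ⟨d, h | h⟩ := half_set k (v.1 - u.1) hδ
    · refine ⟨d, ?_⟩
      have := cov2_ne m hm hodd ((d + 1 : ℕ) : ZMod (2 * k + 1)) u (v.2 - u.2) ha r r'
      have e : (u.1 + ((d + 1 : ℕ) : ZMod (2 * k + 1)), u.2 + (v.2 - u.2)) = v := by
        rw [← h]; ext <;> simp
      rw [e] at this
      exact this
    · refine ⟨d, ?_⟩
      have := cov2_ne m hm hodd ((d + 1 : ℕ) : ZMod (2 * k + 1)) v (u.2 - v.2)
        (fun h => ha (by rw [← neg_sub, h, neg_zero])) r' r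
      have e : (v.1 + ((d + 1 : ℕ) : ZMod (2 * k + 1)), v.2 + (u.2 - v.2)) = u := by
        ext
        · simp only
          linear_combination h
        · simp
      rw [e, Sym2.eq_swap] at this
      exact this

/-- The index type of the family of factors. -/
abbrev HOPIndex (m k : ℕ) : Type :=
  (ZMod (2 * k + 1) × Option (ZMod m) × Fin 2) ⊕
    (Fin k × (ZMod (2 * k + 1) × ZMod (m + 2)) × Fin 2 × Fin 2)

/-- Lemma 5.2: for odd `m ≥ 3`, `k ≥ 0`, `n = (2k+1)(m+2)` and `s = n - (m+2)`,
`HOP(2^⟨s⟩, 4, 2m)` has a solution. -/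
theorem hop_C2_Cm_mod_half (m k n s : ℕ) (hm : 3 ≤ m) (hmodd : Odd m)
    (hn : n = (2 * k + 1) * (m + 2)) (hs : s = n - (m + 2)) :
    HOPSolution n s 2 ![2, m] := by
  have hodd : m % 2 = 1 := Nat.odd_iff.1 hmodd
  have : NeZero m := ⟨by omega⟩
  obtain ⟨φ⟩ : Nonempty (Option (Option (ZMod m)) ≃ ZMod (m + 2)) :=
    ⟨Fintype.equivOfCardEq (by simp [ZMod.card])⟩
  let D : Fin k → ZMod (2 * k + 1) := fun d => ((d + 1 : ℕ) : ZMod (2 * k + 1))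
  have hle : m + 2 ≤ n := by rw [hn]; exact Nat.le_mul_of_pos_left _ (by omega)
  refine solution_two n s m hm (V := ZMod (2 * k + 1) × ZMod (m + 2)) (J := HOPIndex m k)
    (by simp [ZMod.card, hn]) (by omega) ?_
    (Sum.elim (fun w => (w.1, φ none)) (fun w => p2 m (D w.1) w.2.1))
    (Sum.elim (fun w => (w.1, φ (some w.2.1))) (fun w => q2 m (D w.1) w.2.1 w.2.2.1))
    (Sum.elim (fun w => w.2.2) (fun w => w.2.2.2))
    (Sum.elim (fun w i => (w.1, φ (c1 m w.2.1 i))) (fun w => c2 m (D w.1) w.2.1))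
    (Sum.elim (fun w => b1 w.2.1 w.2.2) (fun w => b2 m w.2.2.1 w.2.2.2)) ?_ ?_ ?_ ?_ ?_
  · have h1 : n - 1 = (m + 1) + 2 * k * (m + 2) := by
      rw [hn, add_mul]; omega
    rw [h1, hn]
    simp [ZMod.card]
    ring
  · rintro (⟨z, x, β⟩ | ⟨d, g, x, y⟩)
    · simp
    · exact p2_ne_q2 m (D d) (half_ne k d).1 g x
  · rintro (⟨z, x, β⟩ | ⟨d, g, x, y⟩) i j hi hj h
    · simp only [Sum.elim_inl, Prod.mk.injEq, true_and, EmbeddingLike.apply_eq_iff_eq] at h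
      exact c1_inj m hm hodd x i j hi hj h
    · exact c2_inj m hm (D d) (half_ne k d).1 (half_ne k d).2 g i j hi hj h
  · rintro (⟨z, x, β⟩ | ⟨d, g, x, y⟩) i hi
    · simpa using c1_ne_none m x i
    · exact c2_ne_p2 m hm (D d) (half_ne k d).1 g i hi
  · rintro (⟨z, x, β⟩ | ⟨d, g, x, y⟩) i hi
    · simpa using c1_ne_some m hm x i hi
    · exact c2_ne_q2 m hm (D d) (half_ne k d).1 (half_ne k d).2 g x i
  · intro u v r r' huv
    by_cases h : u.1 = v.1
    · have h2 : φ.symm u.2 ≠ φ.symm v.2 := by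
        intro h3
        exact huv (Prod.ext h (φ.symm.injective h3))
      obtain ⟨x, β, hb⟩ := cov1 m hm hodd (φ.symm u.2) (φ.symm v.2) r r' h2
      have hb' := InBlk_map (fun w => (u.1, φ w)) hb
      refine ⟨Sum.inl (u.1, x, β), ?_⟩
      have e1 : (u.1, φ (φ.symm u.2)) = u := by simp
      have e2 : (u.1, φ (φ.symm v.2)) = v := by rw [h]; simp
      simp only [e1, e2] at hb'
      exact hb'
    · obtain ⟨d, g, x, y, hb⟩ := cov2 m k hm hodd u v r r' h
      exact ⟨Sum.inr (d, g, x, y), hb⟩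
end

section
/- Let k ≥ 1 be an integer, let n = 18k + 1 and s = n − 9. Then HOP(2^⟨s⟩, 4, 6, 8) has a solution, i.e., HOP(2^⟨s⟩, 2m_1, 2m_2, 2m_3) has a solution with (m_1, m_2, m_3) = (2, 3, 4). (In the paper this is stated as: 4K_n^• admits an HOP (C_2, C_3, C_4)-decomposition, which by the paper's Theorem 3.2 is equivalent to the stated HOP solution.) -/
namespace HOPaux

/-- translate of the residue `c` by `t` in the cyclic group of order `n` -/
def V {n : ℕ} (t : Fin n) (c : ℕ) (hn : c < n) : Fin n :=
  if h : t.val + c < n then ⟨t.val + c, h⟩ else ⟨t.val + c - n, by omega⟩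

lemma V_val {n : ℕ} (t : Fin n) (c : ℕ) (hn : c < n) :
    (t.val + c < n ∧ (V t c hn).val = t.val + c) ∨
      (n ≤ t.val + c ∧ (V t c hn).val + n = t.val + c) := by
  unfold V
  split_ifs with h
  · left; exact ⟨h, rfl⟩
  · right; refine ⟨by omega, ?_⟩
    simp only; omega

/-- difference used by the 2-cycle -/
def dd (k i : ℕ) (a : Fin 2) : ℕ := if a = 0 then 2 * i + 2 else 4 * k + 1 + i

/-- couples of the base factor: cycle `c`, position `r` -/
def pos (k i : ℕ) (a : Fin 2) (c : Fin 3) (r : ℕ) : ℕ :=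
  match c with
  | 0 => if r = 0 then 5 * k + 4 * i + 5 else 5 * k + 4 * i + 5 + dd k i a
  | 1 => if r = 0 then 2 else if r = 1 then 2 + (3 * k - i) else 2 + (3 * k + i + 1)
  | 2 => if r = 0 then 1 else if r = 1 then 5 * k + 4 * i + 2 else if r = 2 then 0
      else 5 * k + 4 * i + 4

/-- entry bits -/
def bit (a b : Fin 2) (c : Fin 3) (r : ℕ) : Fin 2 :=
  match c with
  | 0 => if r = 0 then 0 else b
  | 1 => if r = 0 then a else if r = 1 then b else a + b
  | 2 => if r = 0 then a else if r = 1 then b else if r = 2 then a else b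

/-- lower end of each non-spouse edge -/
def lo (k i : ℕ) (σ : Fin 9) : ℕ :=
  match σ with
  | 0 => 5 * k + 4 * i + 5
  | 1 => 5 * k + 4 * i + 5
  | 2 => 2
  | 3 => 2 + (3 * k - i)
  | 4 => 2
  | 5 => 1
  | 6 => 0
  | 7 => 0
  | 8 => 1

/-- difference of each non-spouse edge -/
def df (k i : ℕ) (a : Fin 2) (σ : Fin 9) : ℕ :=
  match σ with
  | 0 => dd k i a
  | 1 => dd k i a
  | 2 => 3 * k - i
  | 3 => 2 * i + 1
  | 4 => 3 * k + i + 1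
  | 5 => 5 * k + 4 * i + 1
  | 6 => 5 * k + 4 * i + 2
  | 7 => 5 * k + 4 * i + 4
  | 8 => 5 * k + 4 * i + 3

/-- bit at the lower end -/
def al (a b : Fin 2) (σ : Fin 9) : Fin 2 :=
  match σ with
  | 0 => 1
  | 1 => 0
  | 2 => a + 1
  | 3 => b + 1
  | 4 => a
  | 5 => a + 1
  | 6 => a
  | 7 => a + 1
  | 8 => a

/-- bit at the upper end -/
def be (a b : Fin 2) (σ : Fin 9) : Fin 2 :=
  match σ with
  | 0 => b
  | 1 => b + 1
  | 2 => b
  | 3 => a + b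
  | 4 => a + b + 1
  | 5 => b
  | 6 => b + 1
  | 7 => b
  | 8 => b + 1

lemma dd_bd (k i : ℕ) (hi : i < k) (a : Fin 2) : 1 ≤ dd k i a ∧ dd k i a ≤ 5 * k := by
  unfold dd; split_ifs <;> omega

lemma pos_lt (k i : ℕ) (hi : i < k) (a : Fin 2) (c : Fin 3) (r : ℕ) :
    pos k i a c r < 18 * k + 1 := by
  have := dd_bd k i hi a
  fin_cases c <;> simp only [pos] <;> split_ifs <;> omega

lemma df_bd (k i : ℕ) (hi : i < k) (a : Fin 2) (σ : Fin 9) :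
    1 ≤ df k i a σ ∧ df k i a σ ≤ 9 * k := by
  have := dd_bd k i hi a
  fin_cases σ <;> simp only [df] <;> omega

lemma lo_df_lt (k i : ℕ) (hi : i < k) (a : Fin 2) (σ : Fin 9) :
    lo k i σ + df k i a σ < 18 * k + 1 := by
  have := dd_bd k i hi a
  fin_cases σ <;> simp only [lo, df] <;> omega

lemma lo_lt (k i : ℕ) (hi : i < k) (σ : Fin 9) : lo k i σ < 18 * k + 1 := by
  have := lo_df_lt k i hi 0 σ
  omega

lemma slot_exists (k d : ℕ) (h1 : 1 ≤ d) (h2 : d ≤ 9 * k) (α β : Fin 2) :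
    ∃ i, i < k ∧ ∃ (a b : Fin 2) (σ : Fin 9), df k i a σ = d ∧ al a b σ = α ∧ be a b σ = β := by
  have two : ∀ a : Fin 2, ∃ (b : Fin 2) (σ : Fin 9), (σ = 0 ∨ σ = 1) ∧
      al a b σ = α ∧ be a b σ = β := by revert α β; decide
  have gen : ∀ σ : Fin 9, 2 ≤ σ → ∃ (a b : Fin 2), al a b σ = α ∧ be a b σ = β := by
    revert α β; decide
  by_cases c1 : d ≤ 2 * k
  · by_cases o : d % 2 = 1
    · obtain ⟨a, b, h⟩ := gen 3 (by decide)
      exact ⟨(d - 1) / 2, by omega, a, b, 3, by simp only [df]; omega, h⟩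
    · obtain ⟨b, σ, hσ, h⟩ := two 0
      refine ⟨(d - 2) / 2, by omega, 0, b, σ, ?_, h⟩
      rcases hσ with rfl | rfl <;> simp [df, dd] <;> omega
  by_cases c2 : d ≤ 3 * k
  · obtain ⟨a, b, h⟩ := gen 2 (by decide)
    exact ⟨3 * k - d, by omega, a, b, 2, by simp only [df]; omega, h⟩
  by_cases c3 : d ≤ 4 * k
  · obtain ⟨a, b, h⟩ := gen 4 (by decide)
    exact ⟨d - 3 * k - 1, by omega, a, b, 4, by simp only [df]; omega, h⟩
  by_cases c4 : d ≤ 5 * k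
  · obtain ⟨b, σ, hσ, h⟩ := two 1
    refine ⟨d - 4 * k - 1, by omega, 1, b, σ, ?_, h⟩
    rcases hσ with rfl | rfl <;> simp [df, dd] <;> omega
  have h4 : (d - 5 * k - 1) % 4 < 4 := Nat.mod_lt _ (by norm_num)
  have hi : (d - 5 * k - 1) / 4 < k := by omega
  by_cases e0 : (d - 5 * k - 1) % 4 = 0
  · obtain ⟨a, b, h⟩ := gen 5 (by decide)
    exact ⟨_, hi, a, b, 5, by simp only [df]; omega, h⟩
  by_cases e1 : (d - 5 * k - 1) % 4 = 1
  · obtain ⟨a, b, h⟩ := gen 6 (by decide)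
    exact ⟨_, hi, a, b, 6, by simp only [df]; omega, h⟩
  by_cases e2 : (d - 5 * k - 1) % 4 = 2
  · obtain ⟨a, b, h⟩ := gen 8 (by decide)
    exact ⟨_, hi, a, b, 8, by simp only [df]; omega, h⟩
  · obtain ⟨a, b, h⟩ := gen 7 (by decide)
    exact ⟨_, hi, a, b, 7, by simp only [df]; omega, h⟩

lemma df_inj (k i i' : ℕ) (hi : i < k) (hi' : i' < k) (a a' : Fin 2) (σ σ' : Fin 9)
    (h : df k i a σ = df k i' a' σ') :
    i = i' ∧ ((σ ≤ 1 ∧ σ' ≤ 1 ∧ a = a') ∨ (2 ≤ σ ∧ σ = σ')) := by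
  have ha : a = 0 ∨ a = 1 := by clear h; revert a; decide
  have ha' : a' = 0 ∨ a' = 1 := by clear h; revert a'; decide
  fin_cases σ <;> fin_cases σ' <;> rcases ha with rfl | rfl <;> rcases ha' with rfl | rfl <;>
    simp [df, dd] at h ⊢ <;> omega

lemma slot_unique (k i i' : ℕ) (hi : i < k) (hi' : i' < k) (a a' b b' : Fin 2) (σ σ' : Fin 9)
    (h : df k i a σ = df k i' a' σ') (h1 : al a b σ = al a' b' σ')
    (h2 : be a b σ = be a' b' σ') : i = i' ∧ a = a' ∧ b = b' ∧ σ = σ' := by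
  obtain ⟨h0, h3⟩ := df_inj k i i' hi hi' a a' σ σ' h
  refine ⟨h0, ?_⟩
  have key1 : ∀ (a b b' : Fin 2) (σ σ' : Fin 9), σ ≤ 1 → σ' ≤ 1 → al a b σ = al a b' σ' →
      be a b σ = be a b' σ' → b = b' ∧ σ = σ' := by decide
  have key2 : ∀ (a a' b b' : Fin 2) (σ : Fin 9), 2 ≤ σ → al a b σ = al a' b' σ →
      be a b σ = be a' b' σ → a = a' ∧ b = b' := by decide
  rcases h3 with ⟨p, q, rfl⟩ | ⟨p, rfl⟩
  · exact ⟨rfl, key1 _ _ _ _ _ p q h1 h2⟩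
  · obtain ⟨x, y⟩ := key2 _ _ _ _ _ p h1 h2
    exact ⟨x, y, rfl⟩

/-- half-lengths -/
abbrev mm : Fin 3 → ℕ := ![2, 3, 4]

lemma mm_le (c : Fin 3) : 2 ≤ mm c ∧ mm c ≤ 4 := by revert c; decide

lemma pos_inj (k i : ℕ) (hi : i < k) (a : Fin 2) (c c' : Fin 3) (r r' : ℕ)
    (hr : r < mm c) (hr' : r' < mm c') (h : pos k i a c r = pos k i a c' r') :
    c = c' ∧ r = r' := by
  have := dd_bd k i hi a
  fin_cases c <;> fin_cases c' <;> simp at hr hr' <;> interval_cases r <;> interval_cases r' <;>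
    simp [pos] at h ⊢ <;> omega

instance (c : Fin 3) : NeZero (2 * mm c) := ⟨by have := mm_le c; omega⟩

lemma val_succ (c : Fin 3) (j : ZMod (2 * mm c)) :
    (j + 1).val = (j.val + 1) % (2 * mm c) := by
  have h1 : 1 < 2 * mm c := by have := mm_le c; omega
  have : Fact (1 < 2 * mm c) := ⟨h1⟩
  rw [ZMod.val_add, ZMod.val_one]

lemma V_inj {n : ℕ} (t : Fin n) (c c' : ℕ) (h : c < n) (h' : c' < n)
    (e : V t c h = V t c' h') : c = c' := by
  have h1 := V_val t c h
  have h2 := V_val t c' h'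
  rw [e] at h1
  have := t.2
  omega

/-- couples of a factor -/
def cpl {k : ℕ} (i : Fin k) (a : Fin 2) (t : Fin (18 * k + 1)) (c : Fin 3) (r : ℕ) :
    Fin (18 * k + 1) := V t (pos k i a c r) (pos_lt k i i.2 a c r)

lemma cpl_inj {k : ℕ} (i : Fin k) (a : Fin 2) (t : Fin (18 * k + 1)) (c c' : Fin 3) (r r' : ℕ)
    (hr : r < mm c) (hr' : r' < mm c') (h : cpl i a t c r = cpl i a t c' r') :
    c = c' ∧ r = r' :=
  pos_inj k i i.2 a c c' r r' hr hr' (V_inj _ _ _ _ _ h)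

lemma isI_iff {n : ℕ} (u v : HOPVertex n) : IsIEdge s(u, v) ↔ v = HOPspouse u := by
  have ss : ∀ w : HOPVertex n, HOPspouse (HOPspouse w) = w := by
    rintro ⟨x, b⟩
    have : b + 1 + 1 = b := by revert b; decide
    simp [HOPspouse, this]
  constructor
  · rintro ⟨w, h⟩
    rcases Sym2.eq_iff.1 h with ⟨rfl, rfl⟩ | ⟨rfl, rfl⟩
    · rfl
    · exact (ss _).symm
  · rintro rfl
    exact ⟨u, rfl⟩

/-- the cycles of a factor -/
def cy {k : ℕ} (i : Fin k) (a b : Fin 2) (t : Fin (18 * k + 1)) (c : Fin 3)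
    (j : ZMod (2 * mm c)) : HOPVertex (18 * k + 1) :=
  (cpl i a t c (j.val / 2), bit a b c (j.val / 2) + (if j.val % 2 = 0 then 0 else 1))

/-- the set of couples used in cycles -/
def used {k : ℕ} (i : Fin k) (a : Fin 2) (t : Fin (18 * k + 1)) : Finset (Fin (18 * k + 1)) :=
  Finset.univ.image (fun x : (c : Fin 3) × Fin (mm c) => cpl i a t x.1 x.2)

lemma used_card {k : ℕ} (i : Fin k) (a : Fin 2) (t : Fin (18 * k + 1)) :
    (used i a t).card = 9 := by
  unfold used
  rw [Finset.card_image_of_injective]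
  · rfl
  · rintro ⟨c, r⟩ ⟨c', r'⟩ h
    obtain ⟨rfl, h2⟩ := cpl_inj i a t c c' r r' r.2 r'.2 h
    rw [Fin.ext h2]

lemma rest_card {k : ℕ} (i : Fin k) (a : Fin 2) (t : Fin (18 * k + 1)) :
    Fintype.card {x // x ∉ used i a t} = 18 * k + 1 - 9 := by
  rw [Fintype.card_subtype_compl]
  simp [used_card]

/-- enumeration of the remaining couples -/
noncomputable def rest {k : ℕ} (i : Fin k) (a : Fin 2) (t : Fin (18 * k + 1)) :
    Fin (18 * k + 1 - 9) ≃ {x // x ∉ used i a t} :=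
  (Fintype.equivFinOfCardEq (rest_card i a t)).symm

lemma cpl_mem {k : ℕ} (i : Fin k) (a : Fin 2) (t : Fin (18 * k + 1)) (c : Fin 3) (r : ℕ)
    (hr : r < mm c) : cpl i a t c r ∈ used i a t :=
  Finset.mem_image.2 ⟨⟨c, ⟨r, hr⟩⟩, Finset.mem_univ _, rfl⟩

lemma half_lt (c : Fin 3) (j : ZMod (2 * mm c)) : j.val / 2 < mm c := by
  have := ZMod.val_lt j
  omega

lemma cy_even {k : ℕ} (i : Fin k) (a b : Fin 2) (t : Fin (18 * k + 1)) (c : Fin 3)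
    (j : ZMod (2 * mm c)) (hj : j.val % 2 = 0) :
    cy i a b t c (j + 1) = HOPspouse (cy i a b t c j) := by
  have h := ZMod.val_lt j
  have h2 : (j + 1).val = j.val + 1 := by
    rw [val_succ, Nat.mod_eq_of_lt (by omega)]
  have h3 : (j.val + 1) / 2 = j.val / 2 := by omega
  have h4 : (j.val + 1) % 2 = 1 := by omega
  simp [cy, HOPspouse, h2, h3, h4, hj]

lemma cy_odd {k : ℕ} (i : Fin k) (a b : Fin 2) (t : Fin (18 * k + 1)) (c : Fin 3)
    (j : ZMod (2 * mm c)) (hj : j.val % 2 = 1) :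
    cy i a b t c j = (cpl i a t c (j.val / 2), bit a b c (j.val / 2) + 1) ∧
    cy i a b t c (j + 1) = (cpl i a t c ((j.val / 2 + 1) % mm c),
      bit a b c ((j.val / 2 + 1) % mm c)) := by
  have h := ZMod.val_lt j
  refine ⟨by simp [cy, hj], ?_⟩
  have h2 : (j + 1).val = 2 * ((j.val / 2 + 1) % mm c) := by
    rw [val_succ, ← Nat.mul_mod_mul_left]
    congr 1
    omega
  simp [cy, h2]

lemma cy_inj {k : ℕ} (i : Fin k) (a b : Fin 2) (t : Fin (18 * k + 1)) (c c' : Fin 3)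
    (j : ZMod (2 * mm c)) (j' : ZMod (2 * mm c')) (h : cy i a b t c j = cy i a b t c' j') :
    (⟨c, j⟩ : (c : Fin 3) × ZMod (2 * mm c)) = ⟨c', j'⟩ := by
  have h1 := congrArg Prod.fst h
  have h2 := congrArg Prod.snd h
  obtain ⟨rfl, h3⟩ := cpl_inj i a t c c' _ _ (half_lt c j) (half_lt c' j') h1
  have h4 : j.val = j'.val := by
    simp only [cy] at h2
    rw [h3] at h2
    have h5 := add_left_cancel h2
    have h6 : j.val % 2 = j'.val % 2 := by
      split_ifs at h5 with p q q
      · omega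
      · exact absurd h5 (by decide)
      · exact absurd h5 (by decide)
      · omega
    omega
  rw [ZMod.val_injective _ h4]

/-- the factor with index `(i, a, b, t)` -/
noncomputable def Fac {k : ℕ} (i : Fin k) (a b : Fin 2) (t : Fin (18 * k + 1)) :
    HOPFactor (18 * k + 1) (18 * k + 1 - 9) 3 mm where
  pair x := ((rest i a t x).1, 0)
  cyc := cy i a b t
  alt_even c j hj := cy_even i a b t c j hj
  alt_odd c j hj := by
    obtain ⟨h1, h2⟩ := cy_odd i a b t c j hj
    rw [isI_iff, h1, h2]
    intro h
    have h3 := congrArg Prod.fst h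
    simp only [HOPspouse] at h3
    have hm := mm_le c
    have hl := half_lt c j
    have := (cpl_inj i a t c c _ _ (Nat.mod_lt _ (by omega)) hl h3).2
    by_cases hh : j.val / 2 + 1 < mm c
    · rw [Nat.mod_eq_of_lt hh] at this; omega
    · have : j.val / 2 + 1 = mm c := by omega
      simp_all
      omega
  spanning := by
    constructor
    · rintro (⟨x, p⟩ | ⟨c, j⟩) (⟨x', p'⟩ | ⟨c', j'⟩) h
      · simp only [Sum.elim_inl] at h
        have h1 : rest i a t x = rest i a t x' := by
          apply Subtype.ext
          have := congrArg Prod.fst h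
          split_ifs at this <;> simpa [HOPspouse] using this
        have h2 := (rest i a t).injective h1
        subst h2
        have h3 : p = p' := by
          have := congrArg Prod.snd h
          revert this
          revert p p'
          simp only [HOPspouse]
          intro p p' _
          fin_cases p <;> fin_cases p' <;> simp
        rw [h3]
      · exfalso
        simp only [Sum.elim_inl, Sum.elim_inr] at h
        have h1 : (rest i a t x).1 = cpl i a t c' (j'.val / 2) := by
          have := congrArg Prod.fst h
          split_ifs at this <;> simpa [HOPspouse, cy] using this
        exact (rest i a t x).2 (h1 ▸ cpl_mem i a t c' _ (half_lt c' j'))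
      · exfalso
        simp only [Sum.elim_inl, Sum.elim_inr] at h
        have h1 : (rest i a t x').1 = cpl i a t c (j.val / 2) := by
          have := congrArg Prod.fst h.symm
          split_ifs at this <;> simpa [HOPspouse, cy] using this
        exact (rest i a t x').2 (h1 ▸ cpl_mem i a t c _ (half_lt c j))
      · exact congrArg Sum.inr (cy_inj i a b t c c' j j' h)
    · rintro ⟨x, p⟩
      by_cases hx : x ∈ used i a t
      · obtain ⟨⟨c, r⟩, -, rfl⟩ := Finset.mem_image.1 hx
        have hr := r.2
        have hp : p = bit a b c r ∨ p = bit a b c r + 1 := by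
          generalize bit a b c r = q
          revert p q; decide
        rcases hp with rfl | rfl
        · refine ⟨Sum.inr ⟨c, ((2 * r.val : ℕ) : ZMod (2 * mm c))⟩, ?_⟩
          have : ((2 * r.val : ℕ) : ZMod (2 * mm c)).val = 2 * r.val :=
            ZMod.val_cast_of_lt (by omega)
          simp only [Sum.elim_inr, cy, this]
          simp
        · refine ⟨Sum.inr ⟨c, ((2 * r.val + 1 : ℕ) : ZMod (2 * mm c))⟩, ?_⟩
          have : ((2 * r.val + 1 : ℕ) : ZMod (2 * mm c)).val = 2 * r.val + 1 :=
            ZMod.val_cast_of_lt (by omega)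
          have e1 : (2 * r.val + 1) / 2 = r.val := by omega
          have e2 : (2 * r.val + 1) % 2 = 1 := by omega
          simp only [Sum.elim_inr, cy, this, e1, e2]
          simp
      · refine ⟨Sum.inl ((rest i a t).symm ⟨x, hx⟩, p), ?_⟩
        fin_cases p <;> simp [HOPspouse]

/-- the edge in slot `σ` -/
def sl {k : ℕ} (i : Fin k) (a b : Fin 2) (t : Fin (18 * k + 1)) (σ : Fin 9) :
    Sym2 (HOPVertex (18 * k + 1)) :=
  s((V t (lo k i σ) (lo_lt k i i.2 σ), al a b σ),
    (V t (lo k i σ + df k i a σ) (lo_df_lt k i i.2 a σ), be a b σ))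

/-- the edge leaving position `r` of cycle `c` -/
def ce {k : ℕ} (i : Fin k) (a b : Fin 2) (t : Fin (18 * k + 1)) (c : Fin 3) (r : ℕ) :
    Sym2 (HOPVertex (18 * k + 1)) :=
  s((cpl i a t c r, bit a b c r + 1), (cpl i a t c ((r + 1) % mm c), bit a b c ((r + 1) % mm c)))

lemma V_congr {n : ℕ} (t : Fin n) (c c' : ℕ) (h : c < n) (h' : c' < n)
    (e : c = c') : V t c h = V t c' h' := by subst e; rfl

lemma s_congr {n : ℕ} (t : Fin n) (c c' d d' : ℕ) (hc : c < n) (hc' : c' < n) (hd : d < n)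
    (hd' : d' < n) (x x' y y' : Fin 2)
    (h : (c = c' ∧ x = x' ∧ d = d' ∧ y = y') ∨ (c = d' ∧ x = y' ∧ d = c' ∧ y = x')) :
    s((V t c hc, x), (V t d hd, y)) = s((V t c' hc', x'), (V t d' hd', y')) := by
  rcases h with ⟨rfl, rfl, rfl, rfl⟩ | ⟨rfl, rfl, rfl, rfl⟩
  · rfl
  · exact Sym2.eq_swap

/-- slot of a cycle edge -/
def so (c : Fin 3) (r : ℕ) : Fin 9 :=
  match c with
  | 0 => if r = 0 then 0 else 1
  | 1 => if r = 0 then 2 else if r = 1 then 3 else 4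
  | 2 => if r = 0 then 5 else if r = 1 then 6 else if r = 2 then 7 else 8

lemma ce_eq {k : ℕ} (i : Fin k) (a b : Fin 2) (t : Fin (18 * k + 1)) (c : Fin 3) (r : ℕ)
    (hr : r < mm c) : ce i a b t c r = sl i a b t (so c r) := by
  have hi := i.2
  have b2 : ∀ b : Fin 2, b + 1 + 1 = b := by decide
  unfold ce sl
  apply s_congr
  have f2 : (2 : ℕ) % 3 = 2 := rfl
  have f3 : (2 : ℕ) % 4 = 2 := rfl
  have f4 : (3 : ℕ) % 4 = 3 := rfl
  fin_cases c <;> simp at hr <;> interval_cases r <;>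
    simp [pos, so, lo, df, bit, al, be, b2] <;> omega

lemma so_surj (σ : Fin 9) : ∃ (c : Fin 3) (r : Fin 4), r.val < mm c ∧ so c r = σ := by
  revert σ; decide

lemma mem_edges {k : ℕ} (i : Fin k) (a b : Fin 2) (t : Fin (18 * k + 1))
    (e : Sym2 (HOPVertex (18 * k + 1))) (he : ¬ IsIEdge e) :
    e ∈ (Fac i a b t).edges ↔ ∃ σ, e = sl i a b t σ := by
  constructor
  · rintro (⟨x, rfl⟩ | ⟨c, j, rfl⟩)
    · exact absurd ⟨_, rfl⟩ he
    · have h2 : j.val % 2 = 0 ∨ j.val % 2 = 1 := by omega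
      rcases h2 with h2 | h2
      · exfalso
        apply he
        rw [isI_iff]
        exact cy_even i a b t c j h2
      · refine ⟨so c (j.val / 2), ?_⟩
        rw [← ce_eq i a b t c _ (half_lt c j)]
        obtain ⟨h3, h4⟩ := cy_odd i a b t c j h2
        change s(cy i a b t c j, cy i a b t c (j + 1)) = _
        rw [h3, h4]
        rfl
  · rintro ⟨σ, rfl⟩
    obtain ⟨c, r, hr, rfl⟩ := so_surj σ
    right
    have e0 : ((2 * r.val + 1 : ℕ) : ZMod (2 * mm c)).val = 2 * r.val + 1 :=
      ZMod.val_cast_of_lt (by omega)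
    refine ⟨c, ((2 * r.val + 1 : ℕ) : ZMod (2 * mm c)), ?_⟩
    rw [← ce_eq i a b t c _ hr]
    change _ = s(cy i a b t c _, cy i a b t c (_ + 1))
    obtain ⟨h3, h4⟩ := cy_odd i a b t c ((2 * r.val + 1 : ℕ) : ZMod (2 * mm c)) (by rw [e0]; omega)
    have e1 : (2 * r.val + 1) / 2 = r.val := by omega
    rw [h3, h4, e0, e1]
    rfl

lemma sl_unique {k : ℕ} (i i' : Fin k) (a a' b b' : Fin 2) (t t' : Fin (18 * k + 1))
    (σ σ' : Fin 9) (h : sl i a b t σ = sl i' a' b' t' σ') :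
    i = i' ∧ a = a' ∧ b = b' ∧ t = t' := by
  have hd := df_bd k i i.2 a σ
  have hd' := df_bd k i' i'.2 a' σ'
  have v1 := V_val t _ (lo_lt k i i.2 σ)
  have v2 := V_val t _ (lo_df_lt k i i.2 a σ)
  have v3 := V_val t' _ (lo_lt k i' i'.2 σ')
  have v4 := V_val t' _ (lo_df_lt k i' i'.2 a' σ')
  have l1 := lo_df_lt k i i.2 a σ
  have l2 := lo_df_lt k i' i'.2 a' σ'
  have t1 := t.2
  have t2 := t'.2
  rcases Sym2.eq_iff.1 h with ⟨p, q⟩ | ⟨p, q⟩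
  · obtain ⟨p1, p2⟩ := Prod.ext_iff.1 p
    obtain ⟨q1, q2⟩ := Prod.ext_iff.1 q
    simp only at p1 p2 q1 q2
    rw [p1] at v1
    rw [q1] at v2
    obtain ⟨x1, x2, x3, x4⟩ := slot_unique k i i' i.2 i'.2 a a' b b' σ σ' (by omega) p2 q2
    have x5 := Fin.ext x1
    subst x5 x2 x3 x4
    exact ⟨rfl, rfl, rfl, Fin.ext (by omega)⟩
  · exfalso
    have p1 := (Prod.ext_iff.1 p).1
    have q1 := (Prod.ext_iff.1 q).1
    simp only at p1 q1
    rw [p1] at v1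
    rw [q1] at v2
    omega

lemma sl_exists_aux {k : ℕ} (u w : Fin (18 * k + 1)) (α β : Fin 2) (d : ℕ) (h1 : 1 ≤ d)
    (h2 : d ≤ 9 * k) (hd : w.val = u.val + d ∨ w.val + (18 * k + 1) = u.val + d) :
    ∃ (i : Fin k) (a b : Fin 2) (t : Fin (18 * k + 1)) (σ : Fin 9),
      s((u, α), (w, β)) = sl i a b t σ := by
  obtain ⟨i, hi, a, b, σ, e1, e2, e3⟩ := slot_exists k d h1 h2 α β
  have l0 := lo_lt k i hi σ
  have l1 := lo_df_lt k i hi a σ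
  have hu := u.2
  have hw := w.2
  obtain ⟨t, ht⟩ : ∃ t : Fin (18 * k + 1),
      t.val + lo k i σ = u.val ∨ t.val + lo k i σ = u.val + (18 * k + 1) := by
    by_cases c : lo k i σ ≤ u.val
    · exact ⟨⟨u.val - lo k i σ, by omega⟩, Or.inl (by simp only; omega)⟩
    · exact ⟨⟨u.val + (18 * k + 1) - lo k i σ, by omega⟩, Or.inr (by simp only; omega)⟩
  refine ⟨⟨i, hi⟩, a, b, t, σ, ?_⟩
  have v1 := V_val t _ l0
  have v2 := V_val t _ l1
  unfold sl
  rw [Sym2.eq_iff]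
  left
  refine ⟨Prod.ext (Fin.ext ?_) e2.symm, Prod.ext (Fin.ext ?_) e3.symm⟩
  · simp only; omega
  · simp only; omega

lemma sl_exists {k : ℕ} (e : Sym2 (HOPVertex (18 * k + 1))) (h : ¬ e.IsDiag)
    (he : ¬ IsIEdge e) :
    ∃ (i : Fin k) (a b : Fin 2) (t : Fin (18 * k + 1)) (σ : Fin 9), e = sl i a b t σ := by
  induction e using Sym2.ind with
  | _ x y =>
  obtain ⟨u, α⟩ := x
  obtain ⟨w, β⟩ := y
  have huw : u.val ≠ w.val := by
    intro c
    have c' := Fin.ext c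
    subst c'
    rw [isI_iff] at he
    rw [Sym2.mk_isDiag_iff] at h
    simp only [HOPspouse, Prod.mk.injEq, true_and] at h he
    revert h he
    revert α β
    decide
  have hu := u.2
  have hw := w.2
  by_cases c1 : u.val < w.val
  · by_cases c2 : w.val - u.val ≤ 9 * k
    · exact sl_exists_aux u w α β (w.val - u.val) (by omega) c2 (by omega)
    · rw [Sym2.eq_swap]
      exact sl_exists_aux w u β α (u.val + (18 * k + 1) - w.val) (by omega) (by omega) (by omega)
  · by_cases c2 : u.val - w.val ≤ 9 * k
    · rw [Sym2.eq_swap]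
      exact sl_exists_aux w u β α (u.val - w.val) (by omega) c2 (by omega)
    · exact sl_exists_aux u w α β (w.val + (18 * k + 1) - u.val) (by omega) (by omega) (by omega)

end HOPaux

/-- Lemma 6.6: for `k ≥ 1`, `n = 18k + 1` and `s = n - 9`,
`HOP(2^⟨s⟩, 4, 6, 8)` has a solution. -/
theorem hop_C2_C3_C4_mod_one (k n s : ℕ) (hk : 1 ≤ k) (hn : n = 18 * k + 1)
    (hs : s = n - 9) :
    HOPSolution n s 3 ![2, 3, 4] := by
  subst hn
  subst hs
  have hc : Fintype.card (Fin k × Fin 2 × Fin 2 × Fin (18 * k + 1)) = 4 * k * (18 * k + 1) := by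
    simp only [Fintype.card_prod, Fintype.card_fin]
    ring
  let E := (Fintype.equivFinOfCardEq hc).symm
  refine ⟨4 * k * (18 * k + 1), ?_, fun x => HOPaux.Fac (E x).1 (E x).2.1 (E x).2.2.1 (E x).2.2.2,
    ?_⟩
  · simp [Fin.sum_univ_succ]
    ring
  · intro e hd he
    obtain ⟨i, a, b, t, σ, h⟩ := HOPaux.sl_exists e hd he
    refine ⟨E.symm (i, a, b, t), ?_, ?_⟩
    · simp only [Equiv.apply_symm_apply]
      exact (HOPaux.mem_edges _ _ _ _ _ he).2 ⟨σ, h⟩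
    · intro y hy
      obtain ⟨σ', h'⟩ := (HOPaux.mem_edges _ _ _ _ _ he).1 hy
      obtain ⟨h1, h2, h3, h4⟩ := HOPaux.sl_unique _ _ _ _ _ _ _ _ _ _ (h'.symm.trans h)
      rw [Equiv.eq_symm_apply]
      exact Prod.ext h1 (Prod.ext h2 (Prod.ext h3 h4))
end

section
/- Let n ≥ 10 be an integer with n ≡ 1 (mod 20) or n ≡ 5 (mod 20), and let s = n − 10. Then HOP(2^⟨s⟩, 4, 4, 6, 6) has a solution, i.e., HOP(2^⟨s⟩, 2m_1, 2m_2, 2m_3, 2m_4) has a solution with (m_1, m_2, m_3, m_4) = (2, 2, 3, 3). (In the paper this is stated as: 4K_n^• admits an HOP (C_2, C_2, C_3, C_3)-decomposition, which by the paper's Theorem 3.2 is equivalent to the stated HOP solution.) -/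
namespace HOPProof

/-- The couple following position `q` in its cycle. -/
def nxt : Fin 10 → Fin 10 := ![1, 0, 3, 2, 5, 6, 4, 8, 9, 7]

/-- First position of the `i`-th cycle. -/
def off : Fin 4 → ℕ := ![0, 2, 4, 7]

/-- Couple position of the `j`-th vertex of the `i`-th cycle. -/
def pos (i : Fin 4) (j : ℕ) : Fin 10 := Fin.ofNat 10 (off i + j / 2)

lemma nxt_ne (q : Fin 10) : nxt q ≠ q := by revert q; decide

lemma nxt_pos (i : Fin 4) (j : ℕ) (hj : j < 2 * ![2, 2, 3, 3] i) (h : j % 2 = 1) :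
    pos i ((j + 1) % (2 * ![2, 2, 3, 3] i)) = nxt (pos i j) := by
  revert j; revert i; decide

lemma pos_surj (q : Fin 10) : ∃ i : Fin 4, ∃ j : ℕ, j < 2 * ![2, 2, 3, 3] i ∧ j % 2 = 0 ∧
    pos i j = q ∧ j + 1 < 2 * ![2, 2, 3, 3] i ∧ pos i (j + 1) = q := by
  have : ∀ q : Fin 10, ∃ i : Fin 4, ∃ j : Fin 6, (j : ℕ) < 2 * ![2, 2, 3, 3] i ∧ (j : ℕ) % 2 = 0 ∧
    pos i j = q ∧ (j : ℕ) + 1 < 2 * ![2, 2, 3, 3] i ∧ pos i (j + 1) = q := by decide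
  obtain ⟨i, j, h⟩ := this q
  exact ⟨i, j, h⟩

lemma two_le (i : Fin 4) : 2 ≤ ![2, 2, 3, 3] i := by revert i; decide

lemma val_succ (m : ℕ) (hm : 2 ≤ m) (j : ZMod (2 * m)) : (j + 1).val = (j.val + 1) % (2 * m) := by
  have : NeZero (2 * m) := ⟨by omega⟩
  have : Fact (1 < 2 * m) := ⟨by omega⟩
  rw [ZMod.val_add, ZMod.val_one]

lemma isIEdge_fst {n : ℕ} {u v : HOPVertex n} (h : IsIEdge s(u, v)) : u.1 = v.1 := by
  obtain ⟨w, hw⟩ := h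
  rw [Sym2.eq_iff] at hw
  rcases hw with ⟨rfl, rfl⟩ | ⟨rfl, rfl⟩ <;> rfl

/-- A vertex of the `i`-th cycle. -/
def cycV {n : ℕ} (p : Fin 10 → Fin n) (o : Fin 10 → Fin 2) (i : Fin 4) (j : ℕ) : HOPVertex n :=
  (p (pos i j), o (pos i j) + Fin.ofNat 2 j)

lemma cyc_even {n : ℕ} (p : Fin 10 → Fin n) (o : Fin 10 → Fin 2) (i : Fin 4)
    (j : ZMod (2 * ![2, 2, 3, 3] i)) (h : j.val % 2 = 0) :
    cycV p o i (j + 1).val = HOPspouse (cycV p o i j.val) := by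
  have h2 := two_le i
  have : NeZero (2 * ![2, 2, 3, 3] i) := ⟨by omega⟩
  have hl := ZMod.val_lt j
  rw [val_succ _ h2, Nat.mod_eq_of_lt (by omega)]
  have e1 : pos i (j.val + 1) = pos i j.val := by
    unfold pos; congr 2; omega
  have e2 : Fin.ofNat 2 (j.val + 1) = Fin.ofNat 2 j.val + 1 := by
    apply Fin.ext; simp [Fin.val_add]
  simp only [cycV, HOPspouse, e1, e2, add_assoc]

lemma cyc_odd {n : ℕ} (p : Fin 10 → Fin n) (o : Fin 10 → Fin 2) (i : Fin 4)
    (j : ZMod (2 * ![2, 2, 3, 3] i)) (h : j.val % 2 = 1) :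
    cycV p o i j.val = (p (pos i j.val), o (pos i j.val) + 1) ∧
    cycV p o i (j + 1).val = (p (nxt (pos i j.val)), o (nxt (pos i j.val))) := by
  have h2 := two_le i
  have : NeZero (2 * ![2, 2, 3, 3] i) := ⟨by omega⟩
  have hl := ZMod.val_lt j
  have e1 : Fin.ofNat 2 j.val = 1 := by apply Fin.ext; simp [h]
  have e2 : Fin.ofNat 2 ((j.val + 1) % (2 * ![2, 2, 3, 3] i)) = 0 := by
    apply Fin.ext
    rw [Fin.val_ofNat, Nat.mod_mul_right_mod]
    simp; omega
  refine ⟨by simp only [cycV, e1], ?_⟩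
  rw [val_succ _ h2]
  simp only [cycV]
  rw [nxt_pos i _ hl h, e2, add_zero]

lemma mkFactor (n s : ℕ) (hn : n = s + 10) (p : Fin 10 → Fin n) (hp : Function.Injective p)
    (o : Fin 10 → Fin 2) : ∃ F : HOPFactor n s 4 ![2, 2, 3, 3], ∀ e, ¬ IsIEdge e →
      (e ∈ F.edges ↔ ∃ q, e = s((p q, o q + 1), (p (nxt q), o (nxt q)))) := by
  have hcard : Fintype.card {x : Fin n // x ∉ Set.range p} = s := by
    classical
    have h2 : (Finset.univ.filter (fun x : Fin n => x ∉ Set.range p)) = (Finset.univ.image p)ᶜ := by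
      ext x; simp
    rw [Fintype.card_subtype, h2, Finset.card_compl, Finset.card_image_of_injective _ hp]
    simp; omega
  let E := Fintype.equivFinOfCardEq hcard
  let pr : Fin s → HOPVertex n := fun a => ((E.symm a).1, 0)
  let cy : (i : Fin 4) → ZMod (2 * ![2, 2, 3, 3] i) → HOPVertex n := fun i j => cycV p o i j.val
  refine ⟨⟨pr, cy, ?_, ?_, ?_⟩, ?_⟩
  · intro i j h
    exact cyc_even p o i j h
  · intro i j h hI
    obtain ⟨h1, h2⟩ := cyc_odd p o i j h
    have := isIEdge_fst hI
    simp only [cy, h1, h2] at this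
    exact nxt_ne _ (hp this).symm
  · have : ∀ i, NeZero (2 * ![2, 2, 3, 3] i) := fun i => ⟨by have := two_le i; omega⟩
    rw [Nat.bijective_iff_surjective_and_card]
    constructor
    · rintro ⟨x, b⟩
      by_cases hx : x ∈ Set.range p
      · obtain ⟨q, rfl⟩ := hx
        obtain ⟨i, j, hj, hj2, hpos, hj', hpos'⟩ := pos_surj q
        have key : ∀ b' : Fin 2, b' = 0 ∨ b' = 1 := by decide
        rcases key (b - o q) with h | h
        · refine ⟨Sum.inr ⟨i, (j : ZMod (2 * ![2, 2, 3, 3] i))⟩, ?_⟩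
          have : Fin.ofNat 2 j = 0 := by apply Fin.ext; simp [hj2]
          simp only [Sum.elim_inr, cy, cycV, ZMod.val_cast_of_lt hj, hpos, this]
          rw [← h]; simp
        · refine ⟨Sum.inr ⟨i, ((j + 1 : ℕ) : ZMod (2 * ![2, 2, 3, 3] i))⟩, ?_⟩
          have : Fin.ofNat 2 (j + 1) = 1 := by apply Fin.ext; simp; omega
          simp only [Sum.elim_inr, cy, cycV, ZMod.val_cast_of_lt hj', hpos', this]
          rw [← h]; simp
      · refine ⟨Sum.inl (E ⟨x, hx⟩, b), ?_⟩
        have key : ∀ b' : Fin 2, b' = 0 ∨ b' = 1 := by decide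
        rcases key b with rfl | rfl <;> simp [pr, HOPspouse]
    · simp only [Nat.card_sum, Nat.card_prod, Nat.card_sigma, Nat.card_zmod, Nat.card_fin]
      simp [Fin.sum_univ_four]; omega
  · intro e he
    constructor
    · rintro (⟨a, rfl⟩ | ⟨i, j, rfl⟩)
      · exact absurd ⟨_, rfl⟩ he
      · rcases Nat.mod_two_eq_zero_or_one j.val with h | h
        · exact absurd ⟨_, by simp only [cy]; rw [cyc_even p o i j h]⟩ he
        · obtain ⟨h1, h2⟩ := cyc_odd p o i j h
          exact ⟨pos i j.val, by simp only [cy, h1, h2]⟩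
    · rintro ⟨q, rfl⟩
      obtain ⟨i, j, hj, hj2, hpos, hj', hpos'⟩ := pos_surj q
      refine Or.inr ⟨i, ((j + 1 : ℕ) : ZMod (2 * ![2, 2, 3, 3] i)), ?_⟩
      have hv := ZMod.val_cast_of_lt hj'
      obtain ⟨h1, h2⟩ := cyc_odd p o i ((j + 1 : ℕ) : ZMod (2 * ![2, 2, 3, 3] i))
        (by rw [hv]; omega)
      rw [hv] at h2
      simp only [cy, h1, h2, hv, hpos']

/-- Non-spouse edges of a labelled block, as ordered pairs. -/
def slotEdge {X : Type} (p : Fin 10 → X) (o : Fin 10 → Fin 2) (q : Fin 10) :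
    (X × Fin 2) × (X × Fin 2) := ((p q, o q + 1), (p (nxt q), o (nxt q)))

lemma solution (n s : ℕ) (hn : n = s + 10) (X : Type) [Fintype X] [DecidableEq X]
    (hX : Fintype.card X = n)
    (K : Type) [Fintype K] (hK : Fintype.card K * 10 = 2 * n * (n - 1))
    (P : K → Fin 10 → X) (hP : ∀ k, Function.Injective (P k)) (O : K → Fin 10 → Fin 2)
    (hcov : ∀ u v : X, u ≠ v → ∀ a b : Fin 2, ∃ k q,
      slotEdge (P k) (O k) q = ((u, a), (v, b)) ∨ slotEdge (P k) (O k) q = ((v, b), (u, a))) :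
    HOPSolution n s 4 ![2, 2, 3, 3] := by
  let φ := Fintype.equivFinOfCardEq hX
  let κ := (Fintype.equivFin K).symm
  refine ⟨Fintype.card K, by simpa [Fin.sum_univ_four] using hK, ?_⟩
  choose F hF using fun k : Fin (Fintype.card K) =>
    mkFactor n s hn (fun q => φ (P (κ k) q)) (φ.injective.comp (hP (κ k))) (O (κ k))
  refine ⟨F, ?_⟩
  let g : K × Fin 10 × Fin 2 → {x : X × X // x.1 ≠ x.2} × Fin 2 × Fin 2 := fun z =>
    if z.2.2 = 0 then
      (⟨(P z.1 z.2.1, P z.1 (nxt z.2.1)), fun h => nxt_ne _ (hP z.1 h).symm⟩,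
        O z.1 z.2.1 + 1, O z.1 (nxt z.2.1))
    else
      (⟨(P z.1 (nxt z.2.1), P z.1 z.2.1), fun h => nxt_ne _ (hP z.1 h)⟩,
        O z.1 (nxt z.2.1), O z.1 z.2.1 + 1)
  have gsurj : Function.Surjective g := by
    rintro ⟨⟨⟨u, v⟩, huv⟩, a, b⟩
    obtain ⟨k, q, h | h⟩ := hcov u v huv a b
    · refine ⟨(k, q, 0), ?_⟩
      simp only [slotEdge, Prod.mk.injEq] at h
      obtain ⟨⟨h1, h2⟩, h3, h4⟩ := h
      simp [g, h1, h2, h3, h4]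
    · refine ⟨(k, q, 1), ?_⟩
      simp only [slotEdge, Prod.mk.injEq] at h
      obtain ⟨⟨h1, h2⟩, h3, h4⟩ := h
      simp [g, h1, h2, h3, h4]
  have hc : Fintype.card (K × Fin 10 × Fin 2) =
      Fintype.card ({x : X × X // x.1 ≠ x.2} × Fin 2 × Fin 2) := by
    have h1 : Fintype.card {x : X × X // x.1 ≠ x.2} = n * n - n := by
      rw [Fintype.card_subtype, ← hX, ← Finset.card_univ, ← Finset.offDiag_card]
      congr 1; ext x; simp
    simp only [Fintype.card_prod, h1, Fintype.card_fin]
    rw [← Nat.mul_sub_one]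
    nlinarith [hK]
  have ginj : Function.Injective g :=
    ((Fintype.bijective_iff_surjective_and_card g).2 ⟨gsurj, hc⟩).1
  intro e hd he
  induction e using Sym2.ind with | _ u v =>
  obtain ⟨u, a⟩ := u
  obtain ⟨v, b⟩ := v
  have huv : φ.symm u ≠ φ.symm v := by
    intro h
    have h := φ.symm.injective h
    subst h
    have key : ∀ a b : Fin 2, a ≠ b → b = a + 1 := by decide
    apply he
    refine ⟨(u, a), ?_⟩
    have hab : a ≠ b := by rintro rfl; exact hd rfl
    rw [key a b hab]; rfl
  apply existsUnique_of_exists_of_unique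
  · obtain ⟨k, q, h⟩ := hcov _ _ huv a b
    refine ⟨κ.symm k, (hF _ _ he).2 ⟨q, ?_⟩⟩
    simp only [slotEdge, Prod.mk.injEq] at h
    rcases h with ⟨⟨h1, h2⟩, h3, h4⟩ | ⟨⟨h1, h2⟩, h3, h4⟩
    · simp [h1, h2, h3, h4]
    · rw [Sym2.eq_swap]; simp [h1, h2, h3, h4]
  · have key : ∀ k, s((u, a), (v, b)) ∈ (F k).edges → ∃ q c,
        g (κ k, q, c) = (⟨(φ.symm u, φ.symm v), huv⟩, a, b) := by
      intro k hk
      obtain ⟨q, hq⟩ := (hF _ _ he).1 hk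
      rw [Sym2.eq_iff] at hq
      simp only [Prod.mk.injEq] at hq
      rcases hq with ⟨⟨h1, h2⟩, h3, h4⟩ | ⟨⟨h1, h2⟩, h3, h4⟩
      · exact ⟨q, 0, by simp [g, h1, h2, h3, h4]⟩
      · exact ⟨q, 1, by simp [g, h1, h2, h3, h4]⟩
    intro k1 k2 h1 h2
    obtain ⟨q1, c1, e1⟩ := key k1 h1
    obtain ⟨q2, c2, e2⟩ := key k2 h2
    have := ginj (e1.trans e2.symm)
    simp only [Prod.mk.injEq] at this
    exact κ.injective this.1

lemma avoid {n : ℕ} [NeZero n] (A B : Finset (ZMod n)) (h : A.card * B.card < n) :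
    ∃ t : ZMod n, ∀ a ∈ A, ∀ b ∈ B, t + b ≠ a := by
  have h1 : (Finset.image₂ (fun a b => a - b) A B).card < Fintype.card (ZMod n) := by
    rw [ZMod.card]
    exact lt_of_le_of_lt (Finset.card_image₂_le _ _ _) h
  obtain ⟨t, ht⟩ := Finset.exists_mem_notMem_of_card_lt_card
    (s := Finset.image₂ (fun a b => a - b) A B) (t := Finset.univ) (by simpa using h1)
  refine ⟨t, fun a ha b hb hab => ht.2 ?_⟩
  rw [Finset.mem_image₂]
  exact ⟨a, ha, b, hb, by rw [← hab]; ring⟩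

/-- The ten couples of a base factor. -/
def basePt {n : ℕ} (x : Fin 4 → ZMod n) (d1 d2 a b a' b' : ZMod n) : Fin 10 → ZMod n :=
  ![x 0, x 0 + d1, x 1, x 1 + d2, x 2, x 2 + a, x 2 + (a + b), x 3, x 3 + a', x 3 + (a' + b')]

lemma exists_base {n : ℕ} [NeZero n] (hn : 17 ≤ n) (d1 d2 a b a' b' : ZMod n)
    (h1 : d1 ≠ 0) (h2 : d2 ≠ 0) (ha : a ≠ 0) (hb : b ≠ 0) (hab : a + b ≠ 0)
    (ha' : a' ≠ 0) (hb' : b' ≠ 0) (hab' : a' + b' ≠ 0) :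
    ∃ x : Fin 4 → ZMod n, Function.Injective (basePt x d1 d2 a b a' b') := by
  obtain ⟨w, hw⟩ := avoid ({0, a, a + b} : Finset (ZMod n)) {0, a', a' + b'} (by
    have := Finset.card_le_three (a := 0) (b := a) (c := a + b)
    have := Finset.card_le_three (a := 0) (b := a') (c := a' + b')
    nlinarith)
  obtain ⟨x, hx⟩ := avoid ({0, a, a + b, w, w + a', w + (a' + b')} : Finset (ZMod n)) {0, d1} (by
    have := Finset.card_le_six (a := 0) (b := a) (c := a + b) (d := w) (e := w + a')
      (f := w + (a' + b'))
    have := Finset.card_le_two (a := 0) (b := d1)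
    nlinarith)
  obtain ⟨y, hy⟩ := avoid (insert x (insert (x + d1)
      ({0, a, a + b, w, w + a', w + (a' + b')} : Finset (ZMod n)))) {0, d2} (by
    have := Finset.card_le_six (a := 0) (b := a) (c := a + b) (d := w) (e := w + a')
      (f := w + (a' + b'))
    have h3 := Finset.card_insert_le (x + d1)
      ({0, a, a + b, w, w + a', w + (a' + b')} : Finset (ZMod n))
    have h4 := Finset.card_insert_le x (insert (x + d1)
      ({0, a, a + b, w, w + a', w + (a' + b')} : Finset (ZMod n)))
    have := Finset.card_le_two (a := 0) (b := d2)
    nlinarith)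
  refine ⟨![x, y, 0, w], ?_⟩
  rw [← List.nodup_ofFn]
  simp only [Finset.mem_insert, Finset.mem_singleton, forall_eq_or_imp, forall_eq, add_zero]
    at hw hx hy
  simp only [basePt, List.ofFn_succ, List.ofFn_zero, List.nodup_cons, List.mem_cons]
  simp [Fin.succ]
  grind

/-- Signs of a base factor. -/
def baseSgn (α β : Fin 2) : Fin 10 → Fin 2 :=
  ![0, α, 0, α, α, β, α + β, α, β, α + β]

/-- An unordered edge is covered by the family. -/
def Covered {X K : Type} (P : K → Fin 10 → X) (O : K → Fin 10 → Fin 2) (u v : X) : Prop :=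
  ∀ a b : Fin 2, ∃ k q,
      slotEdge (P k) (O k) q = ((u, a), (v, b)) ∨ slotEdge (P k) (O k) q = ((v, b), (u, a))

lemma Covered.symm {X K : Type} {P : K → Fin 10 → X} {O : K → Fin 10 → Fin 2} {u v : X}
    (h : Covered P O u v) : Covered P O v u := by
  intro a b
  obtain ⟨k, q, h⟩ := h b a
  exact ⟨k, q, h.symm⟩

lemma cyclicFamily {n : ℕ} [NeZero n] (hn : 17 ≤ n) (J : Type) (e : J → Fin 2 → Fin 2 → ZMod n)
    (a b : J → Fin 2 → ZMod n) (he : ∀ j c i, e j c i ≠ 0) (ha : ∀ j i, a j i ≠ 0)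
    (hb : ∀ j i, b j i ≠ 0) (hab : ∀ j i, a j i + b j i ≠ 0) :
    ∃ (P : ZMod n × J × Fin 2 × Fin 2 → Fin 10 → ZMod n)
      (O : ZMod n × J × Fin 2 × Fin 2 → Fin 10 → Fin 2),
      (∀ k, Function.Injective (P k)) ∧
      (∀ u v j c i, v - u = e j c i → Covered P O u v) ∧
      (∀ u v j i, v - u = a j i ∨ v - u = b j i ∨ v - u = a j i + b j i → Covered P O u v) := by
  choose x hx using fun (j : J) (c : Fin 2) => exists_base hn (e j c 0) (e j c 1)
    (a j 0) (b j 0) (a j 1) (b j 1) (he _ _ _) (he _ _ _) (ha _ _) (hb _ _) (hab _ _)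
    (ha _ _) (hb _ _) (hab _ _)
  let B : J → Fin 2 → Fin 10 → ZMod n := fun j c =>
    basePt (x j c) (e j c 0) (e j c 1) (a j 0) (b j 0) (a j 1) (b j 1)
  let P : ZMod n × J × Fin 2 × Fin 2 → Fin 10 → ZMod n := fun k q => k.1 + B k.2.1 k.2.2.2 q
  let O : ZMod n × J × Fin 2 × Fin 2 → Fin 10 → Fin 2 := fun k => baseSgn k.2.2.1 k.2.2.2
  have key : ∀ (u v : ZMod n) (j : J) (α β f g : Fin 2) (q : Fin 10),
      v - u = B j β (nxt q) - B j β q → baseSgn α β q + 1 = f → baseSgn α β (nxt q) = g →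
      ∃ k q, slotEdge (P k) (O k) q = ((u, f), (v, g)) := by
    intro u v j α β f g q h1 h2 h3
    refine ⟨(u - B j β q, j, α, β), q, ?_⟩
    simp only [slotEdge, P, O, h2, h3, Prod.mk.injEq, and_true]
    refine ⟨by ring, ?_⟩
    linear_combination -h1
  refine ⟨P, O, ?_, ?_, ?_⟩
  · intro k q q' h
    exact hx _ _ (add_left_cancel h)
  · intro u v j c i h f g
    have : ∃ α : Fin 2, (f = 1 ∧ g = α) ∨ (f = 0 ∧ g = α + 1) := by revert f g; decide
    obtain ⟨α, ⟨rfl, rfl⟩ | ⟨rfl, rfl⟩⟩ := this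
    · have : i = 0 ∨ i = 1 := by clear h; revert i; decide
      rcases this with rfl | rfl
      · obtain ⟨k, q, hk⟩ := key u v j g c 1 g 0
          (by rw [h]; simp [B, basePt, nxt]) (by simp [baseSgn]) (by simp [baseSgn, nxt])
        exact ⟨k, q, Or.inl hk⟩
      · obtain ⟨k, q, hk⟩ := key u v j g c 1 g 2
          (by rw [h]; simp [B, basePt, nxt]) (by simp [baseSgn]) (by simp [baseSgn, nxt])
        exact ⟨k, q, Or.inl hk⟩
    · have : i = 0 ∨ i = 1 := by clear h; revert i; decide
      rcases this with rfl | rfl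
      · obtain ⟨k, q, hk⟩ := key v u j α c (α + 1) 0 1
          (by rw [← neg_sub, h]; simp [B, basePt, nxt]) (by simp [baseSgn])
          (by simp [baseSgn, nxt])
        exact ⟨k, q, Or.inr hk⟩
      · obtain ⟨k, q, hk⟩ := key v u j α c (α + 1) 0 3
          (by rw [← neg_sub, h]; simp [B, basePt, nxt]) (by simp [baseSgn])
          (by simp [baseSgn, nxt])
        exact ⟨k, q, Or.inr hk⟩
  · intro u v j i h f g
    have hi : i = 0 ∨ i = 1 := by clear h; revert i; decide
    rcases h with h | h | h
    · rcases hi with rfl | rfl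
      · obtain ⟨k, q, hk⟩ := key u v j (f + 1) g f g 4
          (by rw [h]; simp [B, basePt, nxt]) (by revert f g; decide) (by revert f g; decide)
        exact ⟨k, q, Or.inl hk⟩
      · obtain ⟨k, q, hk⟩ := key u v j (f + 1) g f g 7
          (by rw [h]; simp [B, basePt, nxt]) (by revert f g; decide) (by revert f g; decide)
        exact ⟨k, q, Or.inl hk⟩
    · rcases hi with rfl | rfl
      · obtain ⟨k, q, hk⟩ := key u v j (f + 1 + g) (f + 1) f g 5
          (by rw [h]; simp [B, basePt, nxt]) (by revert f g; decide) (by revert f g; decide)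
        exact ⟨k, q, Or.inl hk⟩
      · obtain ⟨k, q, hk⟩ := key u v j (f + 1 + g) (f + 1) f g 8
          (by rw [h]; simp [B, basePt, nxt]) (by revert f g; decide) (by revert f g; decide)
        exact ⟨k, q, Or.inl hk⟩
    · rcases hi with rfl | rfl
      · obtain ⟨k, q, hk⟩ := key v u j f (f + g + 1) g f 6
          (by rw [← neg_sub, h]; simp [B, basePt, nxt]) (by revert f g; decide)
          (by revert f g; decide)
        exact ⟨k, q, Or.inr hk⟩
      · obtain ⟨k, q, hk⟩ := key v u j f (f + g + 1) g f 9
          (by rw [← neg_sub, h]; simp [B, basePt, nxt]) (by revert f g; decide)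
          (by revert f g; decide)
        exact ⟨k, q, Or.inr hk⟩

lemma natFamily (n k : ℕ) [NeZero n] (hk : 1 ≤ k) (hn : 20 * k + 1 ≤ n) (E : ℕ → ℕ)
    (hE : ∀ r < 4 * k, 0 < E r ∧ E r < n) :
    ∃ (P : ZMod n × Fin k × Fin 2 × Fin 2 → Fin 10 → ZMod n)
      (O : ZMod n × Fin k × Fin 2 × Fin 2 → Fin 10 → Fin 2),
      (∀ k, Function.Injective (P k)) ∧
      ∀ (u v : ZMod n) (δ : ℕ), v - u = (δ : ZMod n) →
        ((∃ r < 4 * k, δ = E r) ∨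
          ∃ i < 2 * k, δ = 2 * i + 1 ∨ δ = 6 * k + 1 - i ∨ δ = 6 * k + 2 + i) →
        Covered P O u v := by
  have hne : ∀ d : ℕ, 0 < d → d < n → (d : ZMod n) ≠ 0 := by
    intro d h1 h2 h
    rw [ZMod.natCast_eq_zero_iff] at h
    exact absurd (Nat.le_of_dvd h1 h) (by omega)
  have hsum : ∀ i : ℕ, i < 2 * k → ((2 * i + 1 : ℕ) : ZMod n) + ((6 * k + 1 - i : ℕ) : ZMod n) =
      ((6 * k + 2 + i : ℕ) : ZMod n) := by
    intro i hi
    rw [← Nat.cast_add]; congr 1; omega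
  obtain ⟨P, O, h1, h2, h3⟩ := cyclicFamily (n := n) (by omega) (Fin k)
    (fun j c i => (E (4 * j.val + 2 * c.val + i.val) : ZMod n))
    (fun j i => ((2 * (2 * j.val + i.val) + 1 : ℕ) : ZMod n))
    (fun j i => ((6 * k + 1 - (2 * j.val + i.val) : ℕ) : ZMod n))
    (fun j c i => by
      have := hE (4 * j.val + 2 * c.val + i.val) (by omega)
      exact hne _ this.1 this.2)
    (fun j i => hne _ (by omega) (by omega))
    (fun j i => hne _ (by omega) (by omega))
    (fun j i => by
      rw [hsum _ (by omega)]
      exact hne _ (by omega) (by omega))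
  refine ⟨P, O, h1, ?_⟩
  rintro u v δ huv (⟨r, hr, rfl⟩ | ⟨i, hi, h⟩)
  · refine h2 u v ⟨r / 4, by omega⟩ ⟨r % 4 / 2, by omega⟩ ⟨r % 2, by omega⟩ ?_
    rw [huv]; congr 2; simp only; omega
  · have hi' : 2 * (i / 2) + i % 2 = i := by omega
    refine h3 u v ⟨i / 2, by omega⟩ ⟨i % 2, by omega⟩ ?_
    simp only [hi', hsum i hi, huv]
    rcases h with rfl | rfl | rfl
    · exact Or.inl rfl
    · exact Or.inr (Or.inl rfl)
    · exact Or.inr (Or.inr rfl)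

lemma exists_diff (n : ℕ) [NeZero n] (u v : ZMod n) (h : u ≠ v) :
    ∃ δ : ℕ, 0 < δ ∧ 2 * δ ≤ n ∧ (v - u = (δ : ZMod n) ∨ u - v = (δ : ZMod n)) := by
  have key : ∀ w : ZMod n, ((w.val : ℕ) : ZMod n) = w := fun w => ZMod.natCast_zmod_val w
  have hne : v - u ≠ 0 := sub_ne_zero.2 h.symm
  have hlt := ZMod.val_lt (v - u)
  have hpos : 0 < (v - u).val := by
    rw [Nat.pos_iff_ne_zero]; simpa using hne
  by_cases h2 : 2 * (v - u).val ≤ n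
  · exact ⟨_, hpos, h2, Or.inl (key _).symm⟩
  · refine ⟨n - (v - u).val, by omega, by omega, Or.inr ?_⟩
    rw [Nat.cast_sub hlt.le, key]; simp

theorem case_one (k s : ℕ) (hk : 1 ≤ k) (hs : 20 * k + 1 = s + 10) :
    HOPSolution (20 * k + 1) s 4 ![2, 2, 3, 3] := by
  obtain ⟨P, O, hP, hc⟩ := natFamily (20 * k + 1) k hk le_rfl
    (fun r => if r < 2 * k then 2 * r + 2 else if r = 2 * k then 4 * k + 1 else 6 * k + 1 + r)
    (by intro r hr; split_ifs <;> omega)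
  have main : ∀ (u v : ZMod (20 * k + 1)) (δ : ℕ), 0 < δ → 2 * δ ≤ 20 * k + 1 →
      v - u = (δ : ZMod (20 * k + 1)) → Covered P O u v := by
    intro u v δ h0 h1 h
    apply hc u v δ h
    by_cases c1 : δ ≤ 4 * k
    · rcases Nat.mod_two_eq_zero_or_one δ with h2 | h2
      · refine Or.inl ⟨δ / 2 - 1, by omega, ?_⟩
        rw [if_pos (by omega)]; omega
      · exact Or.inr ⟨δ / 2, by omega, Or.inl (by omega)⟩
    by_cases c2 : δ = 4 * k + 1
    · refine Or.inl ⟨2 * k, by omega, ?_⟩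
      simp [c2]
    by_cases c3 : δ ≤ 6 * k + 1
    · exact Or.inr ⟨6 * k + 1 - δ, by omega, Or.inr (Or.inl (by omega))⟩
    by_cases c4 : δ ≤ 8 * k + 1
    · exact Or.inr ⟨δ - (6 * k + 2), by omega, Or.inr (Or.inr (by omega))⟩
    · refine Or.inl ⟨δ - (6 * k + 1), by omega, ?_⟩
      rw [if_neg (by omega), if_neg (by omega)]; omega
  refine solution _ s hs (ZMod (20 * k + 1)) (ZMod.card _) _ ?_ P hP O ?_
  · simp only [Fintype.card_prod, ZMod.card, Fintype.card_fin, Nat.add_sub_cancel]; ring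
  · intro u v huv
    obtain ⟨δ, h0, h1, h | h⟩ := exists_diff _ u v huv
    · exact main u v δ h0 h1 h
    · exact (main v u δ h0 h1 h).symm

/-- Couples of the eight factors of the solution on five couples. -/
def tabT : Fin 8 → Fin 5 → Fin 5 :=
  ![![0, 1, 2, 3, 4], ![0, 1, 2, 3, 4], ![0, 2, 1, 3, 4], ![0, 2, 1, 3, 4],
    ![0, 3, 1, 2, 4], ![0, 3, 1, 2, 4], ![0, 4, 1, 2, 3], ![0, 4, 1, 2, 3]]

/-- Signs of the eight factors of the solution on five couples. -/
def tabS : Fin 8 → Fin 5 → Fin 2 :=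
  ![![0, 0, 0, 0, 0], ![0, 1, 0, 1, 1], ![0, 0, 0, 0, 1], ![0, 1, 1, 1, 0],
    ![0, 0, 0, 0, 0], ![0, 1, 1, 0, 1], ![0, 0, 0, 1, 1], ![0, 1, 1, 1, 0]]

/-- Which of the two blocks a position belongs to. -/
def side : Fin 10 → Bool :=
  ![false, false, true, true, false, false, false, true, true, true]

/-- Position inside the block. -/
def idx : Fin 10 → Fin 5 := ![0, 1, 0, 1, 2, 3, 4, 2, 3, 4]

/-- Number of the small factor used at a position. -/
def row (f : Fin 4) (q : Fin 10) : Fin 8 := if side q then Fin.natAdd 4 f else Fin.castAdd 4 f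

lemma side_nxt (q : Fin 10) : side (nxt q) = side q := by revert q; decide

lemma tabT_inj (g : Fin 8) : Function.Injective (tabT g) := by revert g; decide

lemma idx_inj (q q' : Fin 10) (h : side q = side q') (h' : idx q = idx q') : q = q' := by
  revert q q'; decide

lemma tab_cover : ∀ (x y : Fin 5), x ≠ y → ∀ (a b : Fin 2), ∃ (f : Fin 4) (q : Fin 10),
    (tabT (row f q) (idx q) = x ∧ tabS (row f q) (idx q) + 1 = a ∧
      tabT (row f q) (idx (nxt q)) = y ∧ tabS (row f q) (idx (nxt q)) = b) ∨
    (tabT (row f q) (idx q) = y ∧ tabS (row f q) (idx q) + 1 = b ∧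
      tabT (row f q) (idx (nxt q)) = x ∧ tabS (row f q) (idx (nxt q)) = a) := by
  decide +kernel

/-- Point `x` of block `j`. -/
def bl (n m : ℕ) (j : ZMod m) (x : Fin 5) : ZMod n := ((j.val + m * x.val : ℕ) : ZMod n)

lemma blockFamily (n m : ℕ) (hm : 2 ≤ m) (hn : n = 5 * m) :
    ∃ (P : ZMod m × Fin 4 → Fin 10 → ZMod n) (O : ZMod m × Fin 4 → Fin 10 → Fin 2),
      (∀ k, Function.Injective (P k)) ∧
      ∀ (u v : ZMod n), u ≠ v → u.val % m = v.val % m → Covered P O u v := by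
  have : NeZero m := ⟨by omega⟩
  have : NeZero n := ⟨by omega⟩
  have : Fact (1 < m) := ⟨by omega⟩
  have hval : ∀ j x, (bl n m j x).val = j.val + m * x.val := by
    intro j x
    apply ZMod.val_cast_of_lt
    have h1 := ZMod.val_lt j
    have h2 : m * x.val ≤ m * 4 := Nat.mul_le_mul_left _ (by omega)
    omega
  have hinj : ∀ j x j' x', bl n m j x = bl n m j' x' → j = j' ∧ x = x' := by
    intro j x j' x' h
    have h := congrArg ZMod.val h
    rw [hval, hval] at h
    have h1 := ZMod.val_lt j
    have h2 := ZMod.val_lt j'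
    have e1 := congrArg (· % m) h
    have e2 := congrArg (· / m) h
    simp only [Nat.add_mul_mod_self_left, Nat.mod_eq_of_lt h1, Nat.mod_eq_of_lt h2] at e1
    simp only [Nat.add_mul_div_left _ _ (show 0 < m by omega), Nat.div_eq_of_lt h1,
      Nat.div_eq_of_lt h2, zero_add] at e2
    exact ⟨ZMod.val_injective m e1, Fin.ext e2⟩
  have hsurj : ∀ u : ZMod n, ∃ x : Fin 5, bl n m ((u.val % m : ℕ) : ZMod m) x = u := by
    intro u
    have hu := ZMod.val_lt u
    have hd : u.val / m < 5 := by
      rw [Nat.div_lt_iff_lt_mul (by omega)]; omega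
    refine ⟨⟨u.val / m, hd⟩, ?_⟩
    apply ZMod.val_injective n
    rw [hval, ZMod.val_cast_of_lt (Nat.mod_lt _ (by omega))]
    exact Nat.mod_add_div _ _
  let P : ZMod m × Fin 4 → Fin 10 → ZMod n := fun k q =>
    bl n m (if side q then k.1 + 1 else k.1) (tabT (row k.2 q) (idx q))
  let O : ZMod m × Fin 4 → Fin 10 → Fin 2 := fun k q => tabS (row k.2 q) (idx q)
  refine ⟨P, O, ?_, ?_⟩
  · rintro ⟨j, f⟩ q q' h
    obtain ⟨h1, h2⟩ := hinj _ _ _ _ h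
    have hs : side q = side q' := by
      cases hq : side q <;> cases hq' : side q' <;> simp [hq, hq'] at h1 ⊢
    simp only [row, hs] at h2
    exact idx_inj q q' hs (tabT_inj _ h2)
  · intro u v huv hmod a b
    obtain ⟨x, hx⟩ := hsurj u
    obtain ⟨y, hy⟩ := hsurj v
    rw [← hmod] at hy
    generalize ((u.val % m : ℕ) : ZMod m) = j at hx hy
    have hxy : x ≠ y := by rintro rfl; exact huv (hx.symm.trans hy)
    obtain ⟨f, q, h⟩ := tab_cover x y hxy a b
    have hrow : row f (nxt q) = row f q := by simp [row, side_nxt]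
    refine ⟨(if side q then j - 1 else j, f), q, ?_⟩
    have hj : (if side q then (if side q then j - 1 else j) + 1 else
      (if side q then j - 1 else j)) = j := by split_ifs <;> simp
    simp only [slotEdge, P, O, side_nxt, hrow, hj, Prod.mk.injEq]
    rcases h with ⟨h1, h2, h3, h4⟩ | ⟨h1, h2, h3, h4⟩
    · left; simp [h1, h2, h3, h4, hx, hy]
    · right; simp [h1, h2, h3, h4, hx, hy]

lemma covered_sum {X K L : Type} {P : K → Fin 10 → X} {O : K → Fin 10 → Fin 2}
    {P' : L → Fin 10 → X} {O' : L → Fin 10 → Fin 2} {u v : X}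
    (h : Covered P O u v ∨ Covered P' O' u v) :
    Covered (Sum.elim P P') (Sum.elim O O') u v := by
  intro a b
  rcases h with h | h
  · obtain ⟨k, q, h⟩ := h a b
    exact ⟨Sum.inl k, q, h⟩
  · obtain ⟨k, q, h⟩ := h a b
    exact ⟨Sum.inr k, q, h⟩

lemma val_mod_of_diff (n m δ : ℕ) [NeZero n] (hmn : m ∣ n) (hδ : m ∣ δ) (u v : ZMod n)
    (h : v - u = (δ : ZMod n)) : u.val % m = v.val % m := by
  have hv : v = ((u.val + δ : ℕ) : ZMod n) := by
    rw [Nat.cast_add, ZMod.natCast_zmod_val, ← h]; ring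
  rw [hv, ZMod.val_natCast, Nat.mod_mod_of_dvd _ hmn, Nat.add_mod, Nat.mod_eq_zero_of_dvd hδ]
  simp

theorem case_five (k s : ℕ) (hk : 1 ≤ k) (hs : 20 * k + 5 = s + 10) :
    HOPSolution (20 * k + 5) s 4 ![2, 2, 3, 3] := by
  obtain ⟨P, O, hP, hc⟩ := natFamily (20 * k + 5) k hk (by omega)
    (fun r => if r < 2 * k then 2 * r + 2 else 6 * k + 3 + r)
    (by intro r hr; split_ifs <;> omega)
  obtain ⟨P', O', hP', hc'⟩ := blockFamily (20 * k + 5) (4 * k + 1) (by omega) (by ring)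
  have hdvd : 4 * k + 1 ∣ 20 * k + 5 := ⟨5, by ring⟩
  have main : ∀ (u v : ZMod (20 * k + 5)) (δ : ℕ), u ≠ v → 0 < δ → 2 * δ ≤ 20 * k + 5 →
      v - u = (δ : ZMod (20 * k + 5)) → Covered P O u v ∨ Covered P' O' u v := by
    intro u v δ huv h0 h1 h
    by_cases c0 : δ = 4 * k + 1 ∨ δ = 8 * k + 2
    · right
      apply hc' u v huv
      refine val_mod_of_diff _ _ δ hdvd ?_ u v h
      rcases c0 with rfl | rfl
      · exact dvd_rfl
      · exact ⟨2, by ring⟩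
    left
    apply hc u v δ h
    by_cases c1 : δ ≤ 4 * k
    · rcases Nat.mod_two_eq_zero_or_one δ with h2 | h2
      · refine Or.inl ⟨δ / 2 - 1, by omega, ?_⟩
        rw [if_pos (by omega)]; omega
      · exact Or.inr ⟨δ / 2, by omega, Or.inl (by omega)⟩
    by_cases c3 : δ ≤ 6 * k + 1
    · exact Or.inr ⟨6 * k + 1 - δ, by omega, Or.inr (Or.inl (by omega))⟩
    by_cases c4 : δ ≤ 8 * k + 1
    · exact Or.inr ⟨δ - (6 * k + 2), by omega, Or.inr (Or.inr (by omega))⟩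
    · refine Or.inl ⟨δ - (6 * k + 3), by omega, ?_⟩
      rw [if_neg (by omega)]; omega
  refine solution _ s hs (ZMod (20 * k + 5)) (ZMod.card _)
    ((ZMod (20 * k + 5) × Fin k × Fin 2 × Fin 2) ⊕ (ZMod (4 * k + 1) × Fin 4)) ?_
    (Sum.elim P P') ?_ (Sum.elim O O') ?_
  · simp only [Fintype.card_sum, Fintype.card_prod, ZMod.card, Fintype.card_fin]
    rw [show 20 * k + 5 - 1 = 20 * k + 4 by omega]; ring
  · rintro (x | x)
    · exact hP x
    · exact hP' x
  · intro u v huv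
    obtain ⟨δ, h0, h1, h | h⟩ := exists_diff _ u v huv
    · exact covered_sum (main u v δ huv h0 h1 h)
    · exact (covered_sum (main v u δ huv.symm h0 h1 h)).symm

end HOPProof

/-- Lemma 6.8(iii): for `n ≥ 10` with `n ≡ 1` or `5 (mod 20)` and `s = n - 10`,
`HOP(2^⟨s⟩, 4, 4, 6, 6)` has a solution. -/
theorem hop_C2_C2_C3_C3 (n s : ℕ) (hn10 : 10 ≤ n)
    (hcong : n % 20 = 1 ∨ n % 20 = 5) (hs : s = n - 10) :
    HOPSolution n s 4 ![2, 2, 3, 3] := by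
  rcases hcong with h | h
  · obtain ⟨k, rfl⟩ : ∃ k, n = 20 * k + 1 := ⟨n / 20, by omega⟩
    exact HOPProof.case_one k s (by omega) (by omega)
  · obtain ⟨k, rfl⟩ : ∃ k, n = 20 * k + 5 := ⟨n / 20, by omega⟩
    exact HOPProof.case_five k s (by omega) (by omega)
end

section
/- Let k ≥ 1 be an integer, let n = 20k + 1 and s = n − 10. Then HOP(2^⟨s⟩, 4, 6, 10) has a solution, i.e., HOP(2^⟨s⟩, 2m_1, 2m_2, 2m_3) has a solution with (m_1, m_2, m_3) = (2, 3, 5). (In the paper this is stated as: 4K_n^• admits an HOP (C_2, C_3, C_5)-decomposition, which by the paper's Theorem 3.2 is equivalent to the stated HOP solution.) -/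
/-! ### The abstract factor built from ten couples -/

/-- Cyclic successor of a couple inside its cycle (cycles `0-1`, `2-3-4`, `5-6-7-8-9`). -/
def hopNxt : Fin 10 → Fin 10 := ![1, 0, 3, 4, 2, 6, 7, 8, 9, 5]

/-- First couple of each cycle. -/
def hopOff : Fin 3 → ℕ := ![0, 2, 5]

/-- Position `m` of the `i`-th cycle: which couple, and entry (0) or exit (1). -/
def hopLocN (i : Fin 3) (m : ℕ) : Fin 10 × Fin 2 :=
  (Fin.ofNat 10 (hopOff i + m / 2), Fin.ofNat 2 m)

/-- Position `j` of the `i`-th cycle, with `j` taken modulo the length of the cycle. -/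
def hopLoc (i : Fin 3) (j : ZMod (2 * (![2, 3, 5] : Fin 3 → ℕ) i)) : Fin 10 × Fin 2 :=
  hopLocN i j.val

theorem hopLoc_even (i : Fin 3) (j : ZMod (2 * (![2, 3, 5] : Fin 3 → ℕ) i))
    (h : j.val % 2 = 0) : hopLoc i (j + 1) = ((hopLoc i j).1, (hopLoc i j).2 + 1) := by
  have h0 : ∀ j : Fin 4, j.val % 2 = 0 →
      hopLocN 0 (j + 1).val = ((hopLocN 0 j.val).1, (hopLocN 0 j.val).2 + 1) := by decide
  have h1 : ∀ j : Fin 6, j.val % 2 = 0 →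
      hopLocN 1 (j + 1).val = ((hopLocN 1 j.val).1, (hopLocN 1 j.val).2 + 1) := by decide
  have h2 : ∀ j : Fin 10, j.val % 2 = 0 →
      hopLocN 2 (j + 1).val = ((hopLocN 2 j.val).1, (hopLocN 2 j.val).2 + 1) := by decide
  match i, j, h with
  | 0, j, h => exact h0 j h
  | 1, j, h => exact h1 j h
  | 2, j, h => exact h2 j h

theorem hopLoc_odd (i : Fin 3) (j : ZMod (2 * (![2, 3, 5] : Fin 3 → ℕ) i))
    (h : j.val % 2 = 1) : hopLoc i j = ((hopLoc i j).1, 1) ∧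
      hopLoc i (j + 1) = (hopNxt (hopLoc i j).1, 0) := by
  have h0 : ∀ j : Fin 4, j.val % 2 = 1 → hopLocN 0 j.val = ((hopLocN 0 j.val).1, 1) ∧
      hopLocN 0 (j + 1).val = (hopNxt (hopLocN 0 j.val).1, 0) := by decide
  have h1 : ∀ j : Fin 6, j.val % 2 = 1 → hopLocN 1 j.val = ((hopLocN 1 j.val).1, 1) ∧
      hopLocN 1 (j + 1).val = (hopNxt (hopLocN 1 j.val).1, 0) := by decide
  have h2 : ∀ j : Fin 10, j.val % 2 = 1 → hopLocN 2 j.val = ((hopLocN 2 j.val).1, 1) ∧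
      hopLocN 2 (j + 1).val = (hopNxt (hopLocN 2 j.val).1, 0) := by decide
  match i, j, h with
  | 0, j, h => exact h0 j h
  | 1, j, h => exact h1 j h
  | 2, j, h => exact h2 j h

theorem hopLoc_surj (v : Fin 10) (b : Fin 2) : ∃ i j, hopLoc i j = (v, b) := by
  have h : (∃ j : Fin 4, hopLocN 0 j.val = (v, b)) ∨ (∃ j : Fin 6, hopLocN 1 j.val = (v, b)) ∨
      (∃ j : Fin 10, hopLocN 2 j.val = (v, b)) := by
    revert v b
    decide
  rcases h with ⟨j, h⟩ | ⟨j, h⟩ | ⟨j, h⟩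
  · exact ⟨0, j, h⟩
  · exact ⟨1, j, h⟩
  · exact ⟨2, j, h⟩

theorem hopNxt_ne (v : Fin 10) : hopNxt v ≠ v := by
  revert v; decide

/-- The vertex occupying a location. -/
def hopVert {n : ℕ} (P : Fin 10 → Fin n) (σ : Fin 10 → Fin 2) (l : Fin 10 × Fin 2) :
    HOPVertex n := (P l.1, σ l.1 + l.2)

theorem isIEdge_iff {n : ℕ} (u v : HOPVertex n) :
    IsIEdge s(u, v) ↔ u.1 = v.1 ∧ u.2 ≠ v.2 := by
  obtain ⟨x, a⟩ := u
  obtain ⟨y, b⟩ := v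
  have key : ∀ a b : Fin 2, a ≠ b ↔ b = a + 1 := by decide
  have key' : ∀ a : Fin 2, a + 1 + 1 = a := by decide
  constructor
  · rintro ⟨⟨z, c⟩, h⟩
    rw [Sym2.eq_iff] at h
    simp only [HOPspouse, Prod.mk.injEq] at h
    rcases h with ⟨⟨rfl, rfl⟩, rfl, rfl⟩ | ⟨⟨rfl, rfl⟩, rfl, rfl⟩
    · exact ⟨rfl, (key _ _).2 rfl⟩
    · exact ⟨rfl, ((key _ _).2 rfl).symm⟩
  · rintro ⟨h1, h2⟩
    simp only at h1 h2
    subst h1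
    exact ⟨(x, a), by rw [(key _ _).1 h2]; rfl⟩

theorem hop_exists_factor (n s : ℕ) (hs : s + 10 = n) (P : Fin 10 → Fin n)
    (hP : Function.Injective P) (σ : Fin 10 → Fin 2) :
    ∃ F : HOPFactor n s 3 ![2, 3, 5], ∀ e, ¬ IsIEdge e →
      (e ∈ F.edges ↔ ∃ v, e = s((P v, σ v + 1), (P (hopNxt v), σ (hopNxt v)))) := by
  classical
  have hcard : Fintype.card {x : Fin n // x ∉ Set.range P} = s := by
    rw [Fintype.card_subtype]
    have h1 : (Finset.univ.filter fun x : Fin n => x ∉ Set.range P) =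
        (Finset.univ.image P)ᶜ := by
      ext x; simp
    rw [h1, Finset.card_compl, Finset.card_image_of_injective _ hP, Finset.card_univ,
      Fintype.card_fin, Fintype.card_fin]
    omega
  let Q := (Fintype.equivFinOfCardEq hcard).symm
  have hadd : ∀ a b : Fin 2, a + (b - a) = b := by decide
  have h01 : ∀ b : Fin 2, b = 0 ∨ b = 1 := by decide
  haveI hne : ∀ i, NeZero (2 * (![2, 3, 5] : Fin 3 → ℕ) i) := by
    intro i
    refine ⟨?_⟩
    revert i
    decide
  let F : HOPFactor n s 3 ![2, 3, 5] :=
    { pair := fun a => ((Q a).1, 0)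
      cyc := fun i j => hopVert P σ (hopLoc i j)
      alt_even := by
        intro i j h
        rw [hopLoc_even i j h]
        simp [hopVert, HOPspouse, add_assoc]
      alt_odd := by
        intro i j h
        obtain ⟨h1, h2⟩ := hopLoc_odd i j h
        rw [isIEdge_iff, h2]
        rintro ⟨h3, -⟩
        exact hopNxt_ne _ (hP h3).symm
      spanning := by
        rw [Fintype.bijective_iff_surjective_and_card]
        constructor
        · rintro ⟨x, b⟩
          by_cases hx : x ∈ Set.range P
          · obtain ⟨v, rfl⟩ := hx
            obtain ⟨i, j, hij⟩ := hopLoc_surj v (b - σ v)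
            refine ⟨Sum.inr ⟨i, j⟩, ?_⟩
            simp [hij, hopVert, hadd]
          · refine ⟨Sum.inl (Q.symm ⟨x, hx⟩, b), ?_⟩
            rcases h01 b with rfl | rfl
            · simp
            · simp [HOPspouse]
        · simp [Fintype.card_sigma, Fin.sum_univ_three, ZMod.card]
          omega }
  refine ⟨F, fun e he => ?_⟩
  constructor
  · rintro (⟨a, h⟩ | ⟨i, j, h⟩)
    · exact absurd ⟨_, h⟩ he
    · rcases Nat.mod_two_eq_zero_or_one j.val with hj | hj
      · rw [F.alt_even i j hj] at h
        exact absurd ⟨_, h⟩ he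
      · obtain ⟨h1, h2⟩ := hopLoc_odd i j hj
        refine ⟨(hopLoc i j).1, ?_⟩
        rw [h]
        change s(hopVert P σ (hopLoc i j), hopVert P σ (hopLoc i (j + 1))) = _
        rw [h2, h1]
        simp [hopVert]
  · rintro ⟨v, h⟩
    obtain ⟨i, j, hij⟩ := hopLoc_surj v 1
    have hj : j.val % 2 = 1 := by
      have := congrArg (fun l => (l.2 : Fin 2).val) hij
      simpa [hopLoc, hopLocN, Fin.ofNat] using this
    obtain ⟨h1, h2⟩ := hopLoc_odd i j hj
    refine Or.inr ⟨i, j, ?_⟩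
    rw [h]
    change _ = s(hopVert P σ (hopLoc i j), hopVert P σ (hopLoc i (j + 1)))
    rw [h2, hij]
    simp [hopVert]

/-! ### The base factors -/

/-- Couple `v` of base factor `(f, j)` sits at `α k + β + σ j`; the table lists `(α, β, σ)`. -/
def hopTab : Fin 4 → Fin 10 → ℤ × ℤ × ℤ :=
  ![![(0, 0, 0), (8, 1, 1), (16, 0, -1), (18, 1, 0), (17, 1, 1), (12, 0, -1), (7, 0, 0), (13, 0, -1), (3, 0, 0), (7, 1, 1)],
    ![(0, 0, 0), (7, 1, 1), (13, 0, 1), (11, 0, 2), (10, 0, 3), (3, -1, -1), (17, -1, -2), (18, 0, -1), (6, 0, 0), (6, 1, 1)],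
    ![(0, 0, 0), (6, 1, 1), (6, 0, 1), (4, 0, 2), (1, 0, 3), (19, -1, 1), (13, -1, 2), (14, -1, 1), (4, -1, 2), (9, 0, 3)],
    ![(0, 0, 0), (3, 1, 1), (11, 0, 0), (5, 0, 1), (14, 1, 2), (13, -1, -1), (20, 0, 0), (18, -1, -1), (10, -1, 0), (3, -1, 1)]]

/-- The entry member of each couple in the base factors. -/
def hopSgn : Fin 4 → Fin 10 → Fin 2 :=
  ![![1, 0, 0, 1, 0, 1, 0, 1, 0, 1], ![1, 0, 1, 0, 1, 0, 0, 0, 0, 0], ![1, 0, 0, 1, 0, 1, 1, 1, 1, 1], ![1, 0, 1, 0, 1, 1, 1, 1, 1, 1]]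

/-- The integer position described by a coefficient triple. -/
def hopEval (k j : ℤ) (c : ℤ × ℤ × ℤ) : ℤ := c.1 * k + c.2.1 + c.2.2 * j

/-- A sufficient condition for positivity of `hopEval`. -/
def hopPos (c : ℤ × ℤ × ℤ) : Prop := 0 < c.1 + c.2.1 ∧ 0 ≤ c.1 + c.2.2 ∧ 0 ≤ c.1

instance (c : ℤ × ℤ × ℤ) : Decidable (hopPos c) := by
  unfold hopPos; infer_instance

theorem hopEval_pos (k j : ℤ) (hj : 0 ≤ j) (hjk : j < k) (c : ℤ × ℤ × ℤ) (hc : hopPos c) :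
    0 < hopEval k j c := by
  obtain ⟨h1, h2, h3⟩ := hc
  have e : hopEval k j c =
      (c.1 + c.2.1) + (c.1 + c.2.2) * j + c.1 * (k - 1 - j) := by
    unfold hopEval; ring
  have h4 : 0 ≤ (c.1 + c.2.2) * j := mul_nonneg h2 hj
  have h5 : 0 ≤ c.1 * (k - 1 - j) := mul_nonneg h3 (by omega)
  omega

theorem hopEval_sub (k j : ℤ) (c d : ℤ × ℤ × ℤ) :
    hopEval k j (c - d) = hopEval k j c - hopEval k j d := by
  simp only [hopEval, Prod.fst_sub, Prod.snd_sub]; ring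

theorem hopTab_range : ∀ f v, hopPos (hopTab f v + (0, 1, 0)) ∧
    hopPos ((20, 1, 0) - hopTab f v) := by
  decide +kernel

theorem hopTab_distinct : ∀ f v w, v ≠ w → hopPos (hopTab f v - hopTab f w) ∨
    hopPos (hopTab f w - hopTab f v) := by
  decide +kernel

/-- Position of a couple as an element of `ZMod (20 k + 1)`. -/
def hopBase (k : ℕ) (f : Fin 4) (j : Fin k) (v : Fin 10) : ZMod (20 * k + 1) :=
  ((hopEval k (j : ℕ) (hopTab f v) : ℤ) : ZMod (20 * k + 1))

theorem hopBase_injective (k : ℕ) (f : Fin 4) (j : Fin k) :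
    Function.Injective (hopBase k f j) := by
  intro v w h
  by_contra hvw
  have hj : (0 : ℤ) ≤ ((j : ℕ) : ℤ) := by positivity
  have hjk : ((j : ℕ) : ℤ) < (k : ℤ) := by exact_mod_cast j.2
  have hr : ∀ u, 0 ≤ hopEval k (j : ℕ) (hopTab f u) ∧
      hopEval k (j : ℕ) (hopTab f u) < 20 * k + 1 := by
    intro u
    have h1 := hopEval_pos _ _ hj hjk _ (hopTab_range f u).1
    have h2 := hopEval_pos _ _ hj hjk _ (hopTab_range f u).2
    rw [hopEval_sub] at h2
    simp only [hopEval, Prod.fst_add, Prod.snd_add] at h1 h2 ⊢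
    constructor <;> linarith
  unfold hopBase at h
  rw [ZMod.intCast_eq_intCast_iff'] at h
  push_cast at h
  rw [Int.emod_eq_of_lt (hr v).1 (hr v).2, Int.emod_eq_of_lt (hr w).1 (hr w).2] at h
  rcases hopTab_distinct f v w hvw with h' | h'
  · have := hopEval_pos _ _ hj hjk _ h'
    rw [hopEval_sub] at this
    omega
  · have := hopEval_pos _ _ hj hjk _ h'
    rw [hopEval_sub] at this
    omega

/-! ### Directed non-spouse edges of the base factors -/

/-- Start of a directed slot: couple and member. -/
def hopSrc (f : Fin 4) (v : Fin 10) : Bool → Fin 10 × Fin 2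
  | false => (v, hopSgn f v + 1)
  | true => (hopNxt v, hopSgn f (hopNxt v))

/-- End of a directed slot: couple and member. -/
def hopTgt (f : Fin 4) (v : Fin 10) (d : Bool) : Fin 10 × Fin 2 := hopSrc f v (!d)

/-- There is a slot of type `(a, b)` whose difference is `α k + β + σ j` modulo `20 k + 1`. -/
def hopHas (a b : Fin 2) (α β σ : ℤ) : Prop :=
  ∃ f v d, (hopSrc f v d).2 = a ∧ (hopTgt f v d).2 = b ∧
    (hopTab f (hopTgt f v d).1 - hopTab f (hopSrc f v d).1).2.2 = σ ∧
    (hopTab f (hopTgt f v d).1 - hopTab f (hopSrc f v d).1).1 - α =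
      20 * ((hopTab f (hopTgt f v d).1 - hopTab f (hopSrc f v d).1).2.1 - β)

instance (a b : Fin 2) (α β σ : ℤ) : Decidable (hopHas a b α β σ) := by
  unfold hopHas; infer_instance

/-- A pair of consecutive blocks is covered by two slots of slope two. -/
def hopTwo (a b : Fin 2) (p : ℤ) : Prop :=
  (hopHas a b p 1 2 ∨ hopHas a b (p + 2) (-1) (-2)) ∧
    (hopHas a b p 2 2 ∨ hopHas a b (p + 2) 0 (-2))

instance (a b : Fin 2) (p : ℤ) : Decidable (hopTwo a b p) := by
  unfold hopTwo; infer_instance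

theorem hop_table_cover : ∀ (a b : Fin 2) (p : Fin 20),
    hopHas a b (p : ℕ) 1 1 ∨ hopHas a b ((p : ℕ) + 1) 0 (-1) ∨
      hopTwo a b (p : ℕ) ∨ hopTwo a b ((p : ℕ) - 1) := by
  decide +kernel

theorem hopHas_spec (k : ℕ) (a b : Fin 2) (α β σ : ℤ) (h : hopHas a b α β σ) (j : ℕ)
    (hj : j < k) (d : ZMod (20 * k + 1)) (hd : d = ((α * k + β + σ * j : ℤ) : ZMod (20 * k + 1))) :
    ∃ (f : Fin 4) (j : Fin k) (v : Fin 10) (t : Bool),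
      (hopSrc f v t).2 = a ∧ (hopTgt f v t).2 = b ∧
      hopBase k f j (hopTgt f v t).1 - hopBase k f j (hopSrc f v t).1 = d := by
  obtain ⟨f, v, t, h1, h2, h3, h4⟩ := h
  refine ⟨f, ⟨j, hj⟩, v, t, h1, h2, ?_⟩
  rw [hd]
  unfold hopBase
  rw [← Int.cast_sub, ← hopEval_sub]
  generalize hopTab f (hopTgt f v t).1 - hopTab f (hopSrc f v t).1 = c at h3 h4
  have hz : ((20 * k + 1 : ℤ) : ZMod (20 * k + 1)) = 0 := by
    have := ZMod.natCast_self (20 * k + 1)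
    push_cast at this ⊢
    exact this
  have e : hopEval k j c = (α * k + β + σ * j) + (c.2.1 - β) * (20 * k + 1) := by
    unfold hopEval
    rw [h3]
    linear_combination (k : ℤ) * h4
  change ((hopEval k j c : ℤ) : ZMod (20 * k + 1)) = _
  rw [e, Int.cast_add, Int.cast_mul, hz, mul_zero, add_zero]

theorem hopTwo_spec (k : ℕ) (a b : Fin 2) (p : ℤ) (h : hopTwo a b p) (r : ℕ)
    (hr : r < 2 * k) (d : ZMod (20 * k + 1)) (hd : d = ((p * k + 1 + r : ℤ) : ZMod (20 * k + 1))) :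
    ∃ (f : Fin 4) (j : Fin k) (v : Fin 10) (t : Bool),
      (hopSrc f v t).2 = a ∧ (hopTgt f v t).2 = b ∧
      hopBase k f j (hopTgt f v t).1 - hopBase k f j (hopSrc f v t).1 = d := by
  obtain ⟨ho, he⟩ := h
  obtain ⟨i, hi | hi⟩ := Nat.even_or_odd' r
  · have h3 : ((k - 1 - i : ℕ) : ℤ) = k - 1 - i := by omega
    rcases ho with ho | ho
    · refine hopHas_spec k a b _ _ _ ho i (by omega) d ?_
      rw [hd, hi]; push_cast; ring
    · refine hopHas_spec k a b _ _ _ ho (k - 1 - i) (by omega) d ?_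
      rw [hd, hi, h3]; congr 1; push_cast; ring
  · have h3 : ((k - 1 - i : ℕ) : ℤ) = k - 1 - i := by omega
    rcases he with ho | ho
    · refine hopHas_spec k a b _ _ _ ho i (by omega) d ?_
      rw [hd, hi]; congr 1; push_cast; ring
    · refine hopHas_spec k a b _ _ _ ho (k - 1 - i) (by omega) d ?_
      rw [hd, hi, h3]; congr 1; push_cast; ring

theorem hop_cover (k : ℕ) (hk : 1 ≤ k) (d : ZMod (20 * k + 1)) (hd : d ≠ 0) (a b : Fin 2) :
    ∃ (f : Fin 4) (j : Fin k) (v : Fin 10) (t : Bool),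
      (hopSrc f v t).2 = a ∧ (hopTgt f v t).2 = b ∧
      hopBase k f j (hopTgt f v t).1 - hopBase k f j (hopSrc f v t).1 = d := by
  have h0 : d.val ≠ 0 := by rwa [Ne, ZMod.val_eq_zero]
  have hlt : d.val < 20 * k + 1 := ZMod.val_lt d
  have hp : (d.val - 1) / k < 20 := by
    rw [Nat.div_lt_iff_lt_mul (by omega)]; omega
  have hr : (d.val - 1) % k < k := Nat.mod_lt _ (by omega)
  have hdiv := Nat.div_add_mod (d.val - 1) k
  generalize (d.val - 1) / k = p at hp hdiv
  generalize (d.val - 1) % k = r at hr hdiv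
  have hval : d.val = k * p + r + 1 := by omega
  have hdz : d = ((p * k + 1 + r : ℤ) : ZMod (20 * k + 1)) := by
    have h1 : ((d.val : ℕ) : ZMod (20 * k + 1)) = d := ZMod.natCast_zmod_val d
    rw [← h1, hval]; push_cast; ring
  have h3 : ((k - 1 - r : ℕ) : ℤ) = k - 1 - r := by omega
  rcases hop_table_cover a b ⟨p, hp⟩ with h | h | h | h
  · refine hopHas_spec k a b _ _ _ h r hr d ?_
    rw [hdz]; congr 1; push_cast; ring
  · refine hopHas_spec k a b _ _ _ h (k - 1 - r) (by omega) d ?_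
    rw [hdz, h3]; congr 1; push_cast; ring
  · exact hopTwo_spec k a b _ h r (by omega) d hdz
  · refine hopTwo_spec k a b _ h (r + k) (by omega) d ?_
    rw [hdz]; congr 1; push_cast; ring

theorem hopSrc_ne (f : Fin 4) (v : Fin 10) (t : Bool) : (hopSrc f v t).1 ≠ (hopTgt f v t).1 := by
  cases t
  · exact (hopNxt_ne v).symm
  · exact hopNxt_ne v

/-- The difference and type of a directed slot. -/
def hopDart (k : ℕ) (x : Fin 4 × Fin k × Fin 10 × Bool) :
    {d : ZMod (20 * k + 1) // d ≠ 0} × Fin 2 × Fin 2 :=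
  (⟨hopBase k x.1 x.2.1 (hopTgt x.1 x.2.2.1 x.2.2.2).1 -
      hopBase k x.1 x.2.1 (hopSrc x.1 x.2.2.1 x.2.2.2).1, by
      rw [sub_ne_zero]
      exact fun h => hopSrc_ne _ _ _ (hopBase_injective k _ _ h).symm⟩,
    (hopSrc x.1 x.2.2.1 x.2.2.2).2, (hopTgt x.1 x.2.2.1 x.2.2.2).2)

theorem hopDart_bijective (k : ℕ) (hk : 1 ≤ k) : Function.Bijective (hopDart k) := by
  classical
  rw [Fintype.bijective_iff_surjective_and_card]
  constructor
  · rintro ⟨⟨d, hd⟩, a, b⟩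
    obtain ⟨f, j, v, t, h1, h2, h3⟩ := hop_cover k hk d hd a b
    exact ⟨(f, j, v, t), by simp [hopDart, h1, h2, h3]⟩
  · have : Fintype.card {d : ZMod (20 * k + 1) // d ≠ 0} = 20 * k := by
      have h := Fintype.card_subtype_compl (fun d : ZMod (20 * k + 1) => d = 0)
      rw [Fintype.card_subtype_eq, ZMod.card] at h
      simpa using h
    simp only [Fintype.card_prod, this, Fintype.card_fin, Fintype.card_bool]
    ring

/-- Lemma 6.10: for `k ≥ 1`, `n = 20k + 1` and `s = n - 10`,
`HOP(2^⟨s⟩, 4, 6, 10)` has a solution. -/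
theorem hop_C2_C3_C5_mod_one (k n s : ℕ) (hk : 1 ≤ k) (hn : n = 20 * k + 1)
    (hs : s = n - 10) :
    HOPSolution n s 3 ![2, 3, 5] := by
  subst hn
  have hs' : s + 10 = 20 * k + 1 := by omega
  let E : ZMod (20 * k + 1) ≃ Fin (20 * k + 1) := (ZMod.finEquiv (20 * k + 1)).symm.toEquiv
  have hcard : Fintype.card (Fin 4 × Fin k × ZMod (20 * k + 1)) = 4 * (k * (20 * k + 1)) := by
    simp [ZMod.card]
  let X := (Fintype.equivFinOfCardEq hcard).symm
  have hF : ∀ x : Fin 4 × Fin k × ZMod (20 * k + 1),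
      ∃ F : HOPFactor (20 * k + 1) s 3 ![2, 3, 5], ∀ e, ¬ IsIEdge e → (e ∈ F.edges ↔ ∃ v,
        e = s((E (x.2.2 + hopBase k x.1 x.2.1 v), hopSgn x.1 v + 1),
          (E (x.2.2 + hopBase k x.1 x.2.1 (hopNxt v)), hopSgn x.1 (hopNxt v)))) := by
    intro x
    exact hop_exists_factor _ s hs' (fun v => E (x.2.2 + hopBase k x.1 x.2.1 v))
      (fun v w h => hopBase_injective k _ _ (add_left_cancel (E.injective h))) (hopSgn x.1)
  choose F hF using hF
  have hmem : ∀ (x : Fin 4 × Fin k × ZMod (20 * k + 1)) (y z : ZMod (20 * k + 1))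
      (a b : Fin 2) (hyz : z - y ≠ 0),
      s((E y, a), (E z, b)) ∈ (F x).edges ↔ ∃ v t,
        hopDart k (x.1, x.2.1, v, t) = (⟨z - y, hyz⟩, a, b) ∧
          x.2.2 + hopBase k x.1 x.2.1 (hopSrc x.1 v t).1 = y := by
    intro x y z a b hyz
    have hI : ¬ IsIEdge s((E y, a), (E z, b)) := by
      rw [isIEdge_iff]
      rintro ⟨h, -⟩
      exact hyz (sub_eq_zero.2 (E.injective h).symm)
    rw [hF x _ hI]
    refine exists_congr fun v => ?_
    rw [Sym2.eq_iff, Bool.exists_bool]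
    simp only [hopDart, hopTgt, hopSrc, Prod.mk.injEq, E.injective.eq_iff, Subtype.mk.injEq,
      Bool.not_false, Bool.not_true]
    apply or_congr
    · constructor
      · rintro ⟨⟨rfl, rfl⟩, rfl, rfl⟩
        refine ⟨⟨by ring, rfl, rfl⟩, rfl⟩
      · rintro ⟨⟨h, rfl, rfl⟩, rfl⟩
        refine ⟨⟨rfl, rfl⟩, ?_, rfl⟩
        linear_combination -h
    · constructor
      · rintro ⟨⟨rfl, rfl⟩, rfl, rfl⟩
        refine ⟨⟨by ring, rfl, rfl⟩, rfl⟩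
      · rintro ⟨⟨h, rfl, rfl⟩, rfl⟩
        refine ⟨⟨rfl, rfl⟩, ?_, rfl⟩
        linear_combination -h
  refine ⟨4 * (k * (20 * k + 1)), ?_, fun i => F (X i), ?_⟩
  · simp [Fin.sum_univ_three]; ring
  · intro e
    induction e using Sym2.ind with
    | _ u w =>
    obtain ⟨u, a⟩ := u
    obtain ⟨w, b⟩ := w
    obtain ⟨y, rfl⟩ := E.surjective u
    obtain ⟨z, rfl⟩ := E.surjective w
    intro hd hI
    have hyz : z - y ≠ 0 := by
      intro h
      have h' := sub_eq_zero.1 h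
      subst h'
      rw [isIEdge_iff] at hI
      apply hd
      rw [Sym2.mk_isDiag_iff]
      by_contra hab
      exact hI ⟨rfl, fun h => hab (by simp only at h; rw [h])⟩
    obtain ⟨hinj, hsurj⟩ := hopDart_bijective k hk
    obtain ⟨⟨f, j, v, t⟩, hx⟩ := hsurj (⟨z - y, hyz⟩, a, b)
    refine ⟨X.symm (f, j, y - hopBase k f j (hopSrc f v t).1), ?_, ?_⟩
    · simp only [Equiv.apply_symm_apply]
      rw [hmem _ _ _ _ _ hyz]
      exact ⟨v, t, hx, by simp⟩
    · intro i hi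
      simp only at hi
      rw [hmem _ _ _ _ _ hyz] at hi
      obtain ⟨v', t', h1, h2⟩ := hi
      rw [Equiv.eq_symm_apply]
      have h3 := hinj (h1.trans hx.symm)
      rcases hXi : X i with ⟨f', j', c⟩
      rw [hXi] at h2 h3
      simp only [Prod.mk.injEq] at h3
      obtain ⟨rfl, rfl, rfl, rfl⟩ := h3
      simp only [Prod.mk.injEq, true_and]
      rw [← h2]; simp
end
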